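/- arXiv:1802.02454 — 2 statements merged into one kernel-verified Lean document; each statement's English description precedes it below -/
import Mathlib

section
/- The Hausdorff dimension of (M \ L) ∩ (c_inf, C_inf) equals the Hausdorff dimension of the Cantor set Y. -/
open Filter Set

/-- Convergents of the continued fraction `[a 0; a 1, a 2, ...]`. -/
noncomputable def cfConv : (ℕ → ℕ) → ℕ → ℝ
  | a, 0 => (a 0 : ℝ)
  | a, n + 1 => (a 0 : ℝ) + 1 / cfConv (fun i => a (i + 1)) n

/-- Value of the infinite continued fraction `[a 0; a 1, a 2, ...]`,
i.e. the limit of its convergents. -/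
noncomputable def cfVal (a : ℕ → ℕ) : ℝ := limUnder atTop (cfConv a)

/-- Value of the infinite continued fraction `[0; g 0, g 1, g 2, ...]`. -/
noncomputable def cf0 (g : ℕ → ℕ) : ℝ :=
  cfVal (fun n => match n with | 0 => 0 | k + 1 => g k)

/-- `λ_i(A) = [a_i; a_{i+1}, ...] + [0; a_{i-1}, a_{i-2}, ...]` for a bi-infinite
sequence `A`. -/
noncomputable def lam (A : ℤ → ℕ) (i : ℤ) : ℝ :=
  cfVal (fun n => A (i + n)) + cf0 (fun k => A (i - 1 - k))

/-- The Markov value `m(A) = sup_i λ_i(A)`. -/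
noncomputable def markovVal (A : ℤ → ℕ) : ℝ := sSup (Set.range (lam A))

/-- The Lagrange value `ℓ(A) = limsup_{i → +∞} λ_i(A)`. -/
noncomputable def lagrangeVal (A : ℤ → ℕ) : ℝ := limsup (lam A) atTop

/-- The Markov spectrum (Perron's characterization). -/
def MarkovSpectrum : Set ℝ :=
  {x | ∃ A : ℤ → ℕ, (∀ n, 0 < A n) ∧ BddAbove (Set.range (lam A)) ∧ x = markovVal A}

/-- The Lagrange spectrum (Perron's characterization). -/
def LagrangeSpectrum : Set ℝ :=
  {x | ∃ A : ℤ → ℕ, (∀ n, 0 < A n) ∧ IsBoundedUnder (· ≤ ·) atTop (lam A) ∧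
    x = lagrangeVal A}

/-- The purely periodic one-sided sequence with period `w`. -/
def perSeq (w : List ℕ) : ℕ → ℕ := fun n => w.getD (n % w.length) 1

/-- The one-sided sequence beginning with the finite word `p` and continuing with `g`. -/
def catSeq (p : List ℕ) (g : ℕ → ℕ) : ℕ → ℕ :=
  fun n => if n < p.length then p.getD n 1 else g (n - p.length)

/-- The eventually periodic one-sided sequence with preperiod `p` and period `w`. -/
def prePer (p w : List ℕ) : ℕ → ℕ := catSeq p (perSeq w)

/-- The periodic bi-infinite sequence with period `w`. -/
def perZ (w : List ℕ) : ℤ → ℕ := fun n => w.getD ((n % (w.length : ℤ)).toNat) 1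

/-- `c_∞ = [overline(2_4 1_2 2_2 1)] + [0; overline(1 2_2 1_2 2_4)]`. -/
noncomputable def cInf : ℝ :=
  cfVal (perSeq [2,2,2,2,1,1,2,2,1]) + cf0 (perSeq [1,2,2,1,1,2,2,2,2])

/-- `C_∞ = [2; 1, 2_2, 1_2, 2_4, 1, 2_2, 1_2, 2_4, 1, 2_2, 1_2, 2_2, 1, 2_4, 1_2,
overline(2_3 1_3)] + [0; 2_3, 1_2, 2_2, 1, 2_4, 1, overline(1_3 2_3)]`. -/
noncomputable def CInf : ℝ :=
  cfVal (prePer [2,1,2,2,1,1,2,2,2,2,1,2,2,1,1,2,2,2,2,1,2,2,1,1,2,2,1,2,2,2,2,1,1]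
    [2,2,2,1,1,1]) +
  cf0 (prePer [2,2,2,1,1,2,2,1,2,2,2,2,1] [1,1,1,2,2,2])

/-- `f = [overline(2_4 1_2 2_2 1)] + [0; 1, 2_2, 1_2, 2_4, 1, 2_2, 1_2, 2_2, 1_2,
overline(2_3 1_3)]`. -/
noncomputable def fV : ℝ :=
  cfVal (perSeq [2,2,2,2,1,1,2,2,1]) +
  cf0 (prePer [1,2,2,1,1,2,2,2,2,1,2,2,1,1,2,2,1,1] [2,2,2,1,1,1])

/-- `w` occurs in the bi-infinite sequence `A` starting at position `j`. -/
def occursAtZ (w : List ℕ) (A : ℤ → ℕ) (j : ℤ) : Prop :=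
  ∀ i : ℕ, i < w.length → A (j + i) = w.getD i 0

/-- `w` occurs somewhere in the bi-infinite sequence `A`. -/
def occursInZ (w : List ℕ) (A : ℤ → ℕ) : Prop := ∃ j : ℤ, occursAtZ w A j

/-- `w` occurs in the one-sided sequence `g` starting at position `k`. -/
def occursAtN (w : List ℕ) (g : ℕ → ℕ) (k : ℕ) : Prop :=
  ∀ i : ℕ, i < w.length → g (k + i) = w.getD i 0

/-- `w` occurs somewhere in the one-sided sequence `g`. -/
def occursInN (w : List ℕ) (g : ℕ → ℕ) : Prop := ∃ k : ℕ, occursAtN w g k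

def W1 : List ℕ := [1,2,1]
def W2 : List ℕ := [2,2,1,2,2,2,1]
def W3 : List ℕ := [2,2,2,1,2,2,2]
def W4 : List ℕ := [2,2,2,2,2,1,2,2,1,1]
def W5 : List ℕ := [2,2,2,1,1,2,2,2,2,1,2,2,1,1,2,2,2]
def W6 : List ℕ := [2,2,1,1,2,2,2,2,1,2,2,1,1,2,2,2,1]
def W7 : List ℕ := [1,1,2,2,1,1,2,2,2,2,1,2,2,1,1,2,2,2]
def W8 : List ℕ := [2,2,1,2,2,1,1,2,2,2,2,1,2,2,1,1,2,2,2,2,2]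
def W9 : List ℕ := [1,2,2,1,2,2,1,1,2,2,2,2,1,2,2,1,1,2,2,2,2,1]
def W10 : List ℕ := [2,2,2,2,1,2,2,1,1,2,2,2,2,1,2,2,1,1,2,2,2,2,1,1]
def W11 : List ℕ := [2,2,2,2,1,2,2,1,1,2,2,2,2,1,2,2,1,1,2,2,2,2,1,2,2,1,2]
def W12 : List ℕ := [1,2,2,2,2,1,2,2,1,1,2,2,2,2,1,2,2,1,1,2,2,2,2,1,2,2,1,1,1]
def W13 : List ℕ := [2,1,2,2,2,2,1,2,2,1,1,2,2,2,2,1,2,2,1,1,2,2,2,2,1,2,2,1,1,2,2]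

/-- The list of the thirteen words `W_1, …, W_13`. -/
def Wall : List (List ℕ) := [W1,W2,W3,W4,W5,W6,W7,W8,W9,W10,W11,W12,W13]

/-- The words `W_1, …, W_13` together with the (0-based) position of their marked
digit `2^*`. -/
def markedW : List (List ℕ × ℕ) :=
  [(W1,1),(W2,3),(W3,4),(W4,4),(W5,8),(W6,7),(W7,9),(W8,10),(W9,11),(W10,12),
   (W11,12),(W12,13),(W13,14)]

/-- The words `V_15, …, V_21` together with the (0-based) position of their marked
digit `2^*`. -/
def markedV : List (List ℕ × ℕ) :=
  [([1,1,2,2],2),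
   ([2,2,1,2,2,1],3),
   ([2,2,2,2,1,2,2,1,2],3),
   ([1,2,2,2,2,1,2,2,1,1,1],4),
   ([1,2,2,2,2,1,2,2,1,1,2,2,1],4),
   ([2,1,2,2,2,2,1,2,2,1,1,2,2,2],5),
   ([1,1,1,2,2,2,2,1,2,2,1,1,2,2,2],6)]

/-- The word `2 1_2 2_4 1 2_2 1_2 2_3`. -/
def spWord : List ℕ := [2,1,1,2,2,2,2,1,2,2,1,1,2,2,2]

/-- The set `P` of 27 forbidden words: `W_1, …, W_13`, their transposes, and
`2 1_2 2_4 1 2_2 1_2 2_3` together with its transpose. -/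
def Pwords : List (List ℕ) := Wall ++ Wall.map List.reverse ++ [spWord, spWord.reverse]

/-- `g` contains no word of `P` as a consecutive subword. -/
def avoidsP (g : ℕ → ℕ) : Prop := ∀ w ∈ Pwords, ¬ occursInN w g

/-- The Cantor set `Y`. -/
noncomputable def Yset : Set ℝ :=
  {x | ∃ g : ℕ → ℕ, (∀ n, g n = 1 ∨ g n = 2) ∧ avoidsP g ∧ x = cf0 g}

/-- The word `1_2 2_4 1 2_2 1_2 2_4 1 2_2 1_2 2_4 1 2_2 1_2 2_2`. -/
def bigWord : List ℕ :=
  [1,1,2,2,2,2,1,2,2,1,1,2,2,2,2,1,2,2,1,1,2,2,2,2,1,2,2,1,1,2,2]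

/-- The word `1_3 2_4 1 2_2 1_2 2_4 1 2_2 1_2 2_4 1 2_2 1_2 2_2`. -/
def bigWord13 : List ℕ := 1 :: bigWord

/-- `g` is an infinite concatenation of the blocks `(1,1)` and `(2,2)`. -/
def isBlockSeq (g : ℕ → ℕ) : Prop :=
  ∀ n, (g (2*n) = 1 ∧ g (2*n+1) = 1) ∨ (g (2*n) = 2 ∧ g (2*n+1) = 2)

/-- The Gauss–Cantor set `K({1_2, 2_2})`. -/
noncomputable def Kset : Set ℝ := {x | ∃ g : ℕ → ℕ, isBlockSeq g ∧ x = cf0 g}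

/-! ### Convergence of continued fractions -/

lemma cfConv_one_le {a : ℕ → ℕ} (ha : ∀ n, 0 < a n) (n : ℕ) : 1 ≤ cfConv a n := by
  induction n generalizing a with
  | zero =>
    change (1 : ℝ) ≤ (a 0 : ℝ)
    exact_mod_cast ha 0
  | succ n ih =>
    have h1 : (1 : ℝ) ≤ a 0 := by exact_mod_cast ha 0
    have h2 : 1 ≤ cfConv (fun i => a (i + 1)) n := ih fun n => ha (n + 1)
    have h3 : 0 < 1 / cfConv (fun i => a (i + 1)) n := by positivity
    simp only [cfConv]
    linarith

/-- Two steps of the Gauss inverse branches contract by a factor four. -/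
lemma abs_two_step_le {a b s t : ℝ} (ha : 1 ≤ a) (hb : 1 ≤ b) (hs : 0 ≤ s) (ht : 0 ≤ t) :
    |1 / (a + 1 / (b + s)) - 1 / (a + 1 / (b + t))| ≤ 1 / 4 * |s - t| := by
  have hx : 2 ≤ a * (b + s) + 1 := by nlinarith
  have hy : 2 ≤ a * (b + t) + 1 := by nlinarith
  have hbs : 0 < b + s := by linarith
  have hbt : 0 < b + t := by linarith
  have e1 : 1 / (a + 1 / (b + s)) = (b + s) / (a * (b + s) + 1) := by
    field_simp
  have e2 : 1 / (a + 1 / (b + t)) = (b + t) / (a * (b + t) + 1) := by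
    field_simp
  have e : 1 / (a + 1 / (b + s)) - 1 / (a + 1 / (b + t))
      = (s - t) / ((a * (b + s) + 1) * (a * (b + t) + 1)) := by
    rw [e1, e2, div_sub_div _ _ (by positivity) (by positivity)]
    congr 1; ring
  rw [e, abs_div, abs_of_pos (a := (a * (b + s) + 1) * (a * (b + t) + 1)) (by positivity),
    div_le_iff₀ (by positivity)]
  have h4 : 4 ≤ (a * (b + s) + 1) * (a * (b + t) + 1) := by nlinarith
  nlinarith [abs_nonneg (s - t)]

lemma abs_cfConv_sub_le (n k : ℕ) {a : ℕ → ℕ} (ha : ∀ n, 0 < a n) :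
    |cfConv a (2 * n + k) - cfConv a (2 * n)| ≤ (1 / 4) ^ n := by
  induction n generalizing a with
  | zero =>
    cases k with
    | zero => simp
    | succ k =>
      have h : 1 ≤ cfConv (fun i => a (i + 1)) k := cfConv_one_le (fun n => ha (n + 1)) k
      have h0 : 0 < 1 / cfConv (fun i => a (i + 1)) k := by positivity
      have h1 : 1 / cfConv (fun i => a (i + 1)) k ≤ 1 := by
        rw [div_le_one (by linarith)]; exact h
      have e : 2 * 0 + (k + 1) = k + 1 := by omega
      rw [e]
      simp only [cfConv, add_sub_cancel_left, pow_zero]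
      rwa [abs_of_pos h0]
  | succ n ih =>
    have h := ih (a := fun i => a (i + 2)) fun n => ha (n + 2)
    have e1 : 2 * (n + 1) + k = (2 * n + k) + 1 + 1 := by ring
    have e2 : 2 * (n + 1) = 2 * n + 1 + 1 := by ring
    have u1 := cfConv_one_le (a := fun i => a (i + 2)) (fun n => ha (n + 2)) (2 * n + k)
    have u2 := cfConv_one_le (a := fun i => a (i + 2)) (fun n => ha (n + 2)) (2 * n)
    have ha1 : (1 : ℝ) ≤ a 1 := by exact_mod_cast ha 1
    rw [e1, e2]
    simp only [cfConv, zero_add, add_sub_add_left_eq_sub]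
    have e3 : (fun i => (fun i => a (i + 1)) (i + 1)) = fun i => a (i + 2) := rfl
    rw [e3]
    set u := cfConv (fun i => a (i + 2)) (2 * n + k)
    set v := cfConv (fun i => a (i + 2)) (2 * n)
    have h5 : |1 / ((a 1 : ℝ) + 1 / u) - 1 / (a 1 + 1 / v)| ≤ 1 / 4 * |u - v| := by
      have := abs_two_step_le (a := a 1) (b := 1) (s := u - 1) (t := v - 1) ha1 le_rfl
        (by linarith) (by linarith)
      simpa using this
    calc _ ≤ 1 / 4 * |u - v| := h5
      _ ≤ (1 / 4) ^ (n + 1) := by rw [pow_succ']; gcongr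

lemma tendsto_cfConv {a : ℕ → ℕ} (ha : ∀ n, 0 < a n) :
    Tendsto (cfConv a) atTop (nhds (cfVal a)) := by
  have hc : CauchySeq (cfConv a) := by
    refine cauchySeq_of_le_tendsto_0 (fun N => 2 * (1 / 4 : ℝ) ^ (N / 2)) ?_ ?_
    · intro n m N hn hm
      obtain ⟨k, rfl⟩ := Nat.exists_eq_add_of_le (show 2 * (N / 2) ≤ n by omega)
      obtain ⟨l, rfl⟩ := Nat.exists_eq_add_of_le (show 2 * (N / 2) ≤ m by omega)
      have h1 := abs_cfConv_sub_le (N / 2) k ha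
      have h2 := abs_cfConv_sub_le (N / 2) l ha
      rw [Real.dist_eq]
      rw [abs_sub_comm] at h2
      have := abs_sub_le (cfConv a (2 * (N / 2) + k)) (cfConv a (2 * (N / 2)))
        (cfConv a (2 * (N / 2) + l))
      linarith
    · have h1 : Tendsto (fun N : ℕ => N / 2) atTop atTop :=
        Nat.tendsto_div_const_atTop (by norm_num)
      have h2 := (tendsto_pow_atTop_nhds_zero_of_lt_one (r := (1 / 4 : ℝ)) (by norm_num)
        (by norm_num)).comp h1
      simpa using h2.const_mul 2
  exact hc.tendsto_limUnder

lemma cfVal_one_le {a : ℕ → ℕ} (ha : ∀ n, 0 < a n) : 1 ≤ cfVal a :=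
  ge_of_tendsto' (tendsto_cfConv ha) (cfConv_one_le ha)

lemma cfVal_eq {a : ℕ → ℕ} (ha : ∀ n, 0 < a (n + 1)) :
    cfVal a = a 0 + 1 / cfVal (fun n => a (n + 1)) := by
  have h := tendsto_cfConv (a := fun n => a (n + 1)) ha
  have h1 := cfVal_one_le (a := fun n => a (n + 1)) ha
  have h2 : Tendsto (fun n => cfConv a (n + 1)) atTop
      (nhds (a 0 + 1 / cfVal (fun n => a (n + 1)))) :=
    (tendsto_const_nhds.div h (by linarith)).const_add _
  exact ((tendsto_add_atTop_iff_nat 1).1 h2).limUnder_eq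

lemma cf0_eq_inv {g : ℕ → ℕ} (hg : ∀ n, 0 < g n) : cf0 g = 1 / cfVal g := by
  unfold cf0
  rw [cfVal_eq hg]
  simp

lemma cfVal_eq_add_cf0 {a : ℕ → ℕ} (ha : ∀ n, 0 < a (n + 1)) :
    cfVal a = a 0 + cf0 (fun n => a (n + 1)) := by
  rw [cfVal_eq ha, cf0_eq_inv ha]

lemma cf0_eq {g : ℕ → ℕ} (hg : ∀ n, 0 < g n) :
    cf0 g = 1 / (g 0 + cf0 (fun n => g (n + 1))) := by
  rw [cf0_eq_inv hg, cfVal_eq_add_cf0 fun n => hg (n + 1)]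

lemma cf0_pos {g : ℕ → ℕ} (hg : ∀ n, 0 < g n) : 0 < cf0 g := by
  have := cfVal_one_le hg
  rw [cf0_eq_inv hg]; positivity

lemma cf0_le_one {g : ℕ → ℕ} (hg : ∀ n, 0 < g n) : cf0 g ≤ 1 := by
  have := cfVal_one_le hg
  rw [cf0_eq_inv hg, div_le_one (by linarith)]; exact this

lemma third_le_cf0 {g : ℕ → ℕ} (hg : ∀ n, 0 < g n) (h0 : g 0 ≤ 2) : 1 / 3 ≤ cf0 g := by
  have h1 := cf0_le_one (g := fun n => g (n + 1)) fun n => hg (n + 1)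
  have h2 := cf0_pos (g := fun n => g (n + 1)) fun n => hg (n + 1)
  have h3 : (g 0 : ℝ) ≤ 2 := by exact_mod_cast h0
  have h4 : (1 : ℝ) ≤ g 0 := by exact_mod_cast hg 0
  rw [cf0_eq hg]
  exact one_div_le_one_div_of_le (by linarith) (by linarith)

lemma cf0_le_three_quarters {g : ℕ → ℕ} (hg : ∀ n, 0 < g n) (h1 : g 1 ≤ 2) :
    cf0 g ≤ 3 / 4 := by
  have h2 := third_le_cf0 (g := fun n => g (n + 1)) (fun n => hg (n + 1)) h1
  have h4 : (1 : ℝ) ≤ g 0 := by exact_mod_cast hg 0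
  rw [cf0_eq hg, show (3 / 4 : ℝ) = 1 / (4 / 3) by norm_num]
  exact one_div_le_one_div_of_le (by linarith) (by linarith)

/-! ### Finite prefixes as Möbius maps -/

/-- The map `t ↦ [0; w, 1/t]`. -/
noncomputable def mob (w : List ℕ) (t : ℝ) : ℝ := w.foldr (fun d s => 1 / ((d : ℝ) + s)) t

/-- The prefix of length `n` of `g`. -/
def pre (g : ℕ → ℕ) (n : ℕ) : List ℕ := (List.range n).map g

@[simp] lemma mob_nil (t : ℝ) : mob [] t = t := rfl

@[simp] lemma mob_cons (d : ℕ) (w : List ℕ) (t : ℝ) :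
    mob (d :: w) t = 1 / ((d : ℝ) + mob w t) := rfl

@[simp] lemma length_pre (g : ℕ → ℕ) (n : ℕ) : (pre g n).length = n := by simp [pre]

lemma pre_zero (g : ℕ → ℕ) : pre g 0 = [] := rfl

lemma pre_succ (g : ℕ → ℕ) (n : ℕ) : pre g (n + 1) = pre g n ++ [g n] := by
  simp [pre, List.range_succ]

lemma pre_succ' (g : ℕ → ℕ) (n : ℕ) : pre g (n + 1) = g 0 :: pre (fun k => g (k + 1)) n := by
  simp [pre, List.range_succ_eq_map, Function.comp_def]

lemma getElem_pre (g : ℕ → ℕ) (n k : ℕ) (h : k < (pre g n).length) : (pre g n)[k] = g k := by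
  simp [pre]

lemma pos_of_mem_pre {g : ℕ → ℕ} (hg : ∀ n, 0 < g n) (n : ℕ) : ∀ d ∈ pre g n, 0 < d := by
  intro d hd
  obtain ⟨k, -, rfl⟩ := List.mem_map.1 hd
  exact hg k

lemma pre_congr {g h : ℕ → ℕ} {n : ℕ} (e : ∀ k < n, g k = h k) : pre g n = pre h n :=
  List.map_congr_left fun k hk => e k (List.mem_range.1 hk)

lemma getD_of_pre_eq {g : ℕ → ℕ} {n : ℕ} {w : List ℕ} (e : pre g n = w) {k : ℕ} (hk : k < n)
    (d : ℕ) : g k = w.getD k d := by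
  subst e
  rw [List.getD_eq_getElem _ _ (by simpa using hk), getElem_pre]

lemma pre_add (g : ℕ → ℕ) (m n : ℕ) : pre g (m + n) = pre g m ++ pre (fun k => g (m + k)) n := by
  simp [pre, List.range_add, Function.comp_def]

lemma cf0_eq_mob {g : ℕ → ℕ} (hg : ∀ n, 0 < g n) (n : ℕ) :
    cf0 g = mob (pre g n) (cf0 fun k => g (n + k)) := by
  induction n generalizing g with
  | zero => simp [pre_zero]
  | succ n ih =>
    rw [pre_succ', mob_cons, cf0_eq hg, ih fun n => hg (n + 1)]
    simp only [Nat.add_right_comm]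

lemma mob_nonneg {w : List ℕ} {t : ℝ} (ht : 0 ≤ t) : 0 ≤ mob w t := by
  induction w with
  | nil => simpa
  | cons d w ih => rw [mob_cons]; positivity

lemma mob_le_one {w : List ℕ} (hw : ∀ d ∈ w, 0 < d) {t : ℝ} (ht : 0 ≤ t) (ht1 : t ≤ 1) :
    mob w t ≤ 1 := by
  cases w with
  | nil => simpa
  | cons d w =>
    have h1 : (1 : ℝ) ≤ d := by exact_mod_cast hw d (by simp)
    have := mob_nonneg (w := w) ht
    rw [mob_cons, div_le_one (by linarith)]
    linarith

lemma mob_mono {w : List ℕ} (hw : ∀ d ∈ w, 0 < d) {s t : ℝ} (hs : 0 ≤ s) (hst : s ≤ t) :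
    if w.length % 2 = 0 then mob w s ≤ mob w t else mob w t ≤ mob w s := by
  induction w with
  | nil => simpa
  | cons d w ih =>
    have h1 : (1 : ℝ) ≤ d := by exact_mod_cast hw d (by simp)
    have h := ih fun d hd => hw d (by simp [hd])
    have hs' := mob_nonneg (w := w) hs
    have ht' := mob_nonneg (w := w) (hs.trans hst)
    simp only [List.length_cons, mob_cons]
    split_ifs at h with h2
    · rw [if_neg (by omega)]
      exact one_div_le_one_div_of_le (by linarith) (by linarith)
    · rw [if_pos (by omega)]
      exact one_div_le_one_div_of_le (by linarith) (by linarith)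

lemma abs_one_div_sub_le {d s t : ℝ} (hd : 1 ≤ d) (hs : 0 ≤ s) (ht : 0 ≤ t) :
    |1 / (d + s) - 1 / (d + t)| ≤ |s - t| := by
  have e : 1 / (d + s) - 1 / (d + t) = (t - s) / ((d + s) * (d + t)) := by
    rw [div_sub_div _ _ (by positivity) (by positivity)]
    congr 1; ring
  rw [e, abs_div, abs_of_pos (a := (d + s) * (d + t)) (by positivity), abs_sub_comm,
    div_le_iff₀ (by positivity)]
  have : 1 ≤ (d + s) * (d + t) := by nlinarith
  nlinarith [abs_nonneg (s - t)]

lemma abs_mob_sub_le {w : List ℕ} (hw : ∀ d ∈ w, 0 < d) {s t : ℝ} (hs : 0 ≤ s) (ht : 0 ≤ t) :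
    |mob w s - mob w t| ≤ |s - t| := by
  induction w with
  | nil => simp
  | cons d w ih =>
    have h1 : (1 : ℝ) ≤ d := by exact_mod_cast hw d (by simp)
    exact (abs_one_div_sub_le h1 (mob_nonneg hs) (mob_nonneg ht)).trans
      (ih fun d hd => hw d (by simp [hd]))

lemma abs_mob_sub_le_pow (n : ℕ) {w : List ℕ} (hn : w.length = 2 * n) (hw : ∀ d ∈ w, 0 < d)
    {s t : ℝ} (hs : 0 ≤ s) (ht : 0 ≤ t) :
    |mob w s - mob w t| ≤ (1 / 4) ^ n * |s - t| := by
  induction n generalizing w with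
  | zero =>
    obtain rfl : w = [] := List.length_eq_zero_iff.1 hn
    simp
  | succ n ih =>
    match w, hn with
    | a :: b :: w, hn =>
      have ha : (1 : ℝ) ≤ a := by exact_mod_cast hw a (by simp)
      have hb : (1 : ℝ) ≤ b := by exact_mod_cast hw b (by simp)
      have h := ih (w := w) (by simp at hn; omega) fun d hd => hw d (by simp [hd])
      simp only [mob_cons]
      refine (abs_two_step_le ha hb (mob_nonneg hs) (mob_nonneg ht)).trans ?_
      rw [pow_succ']
      nlinarith

lemma abs_cf0_sub_le {g h : ℕ → ℕ} (hg : ∀ n, 0 < g n) (hh : ∀ n, 0 < h n) (n : ℕ)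
    (e : ∀ k < 2 * n, g k = h k) : |cf0 g - cf0 h| ≤ (1 / 4) ^ n := by
  rw [cf0_eq_mob hg (2 * n), cf0_eq_mob hh (2 * n), ← pre_congr e]
  have g' : ∀ k, 0 < g (2 * n + k) := fun k => hg _
  have h' : ∀ k, 0 < h (2 * n + k) := fun k => hh _
  refine (abs_mob_sub_le_pow n (length_pre _ _) (pos_of_mem_pre hg _) (cf0_pos g').le
    (cf0_pos h').le).trans ?_
  have : |(cf0 fun k => g (2 * n + k)) - cf0 fun k => h (2 * n + k)| ≤ 1 := by
    rw [abs_sub_le_iff]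
    constructor <;> linarith [cf0_pos g', cf0_pos h', cf0_le_one g', cf0_le_one h']
  nlinarith [pow_pos (show (0 : ℝ) < 1 / 4 by norm_num) n]

/-! ### Bi-infinite sequences seen from a position -/

/-- The digits to the left of position `i`, read outwards. -/
def lseq (A : ℤ → ℕ) (i : ℤ) : ℕ → ℕ := fun k => A (i - 1 - k)

/-- The digits to the right of position `i`, read outwards. -/
def rseq (A : ℤ → ℕ) (i : ℤ) : ℕ → ℕ := fun k => A (i + 1 + k)

/-- The sequence read backwards. -/
def rev (A : ℤ → ℕ) : ℤ → ℕ := fun n => A (-n)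

lemma rev_rev (A : ℤ → ℕ) : rev (rev A) = A := by
  funext n; simp [rev]

lemma lseq_rev (A : ℤ → ℕ) (i : ℤ) : lseq (rev A) i = rseq A (-i) := by
  funext k; simp only [lseq, rseq, rev]; congr 1; ring

lemma rseq_rev (A : ℤ → ℕ) (i : ℤ) : rseq (rev A) i = lseq A (-i) := by
  funext k; simp only [lseq, rseq, rev]; congr 1; ring

lemma lam_eq {A : ℤ → ℕ} (hA : ∀ n, 0 < A n) (i : ℤ) :
    lam A i = A i + cf0 (rseq A i) + cf0 (lseq A i) := by
  have e1 : (fun n : ℕ => A (i + (n + 1 : ℕ))) = rseq A i := by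
    funext n; simp only [rseq]; congr 1; push_cast; ring
  have h := cfVal_eq_add_cf0 (a := fun n : ℕ => A (i + n)) fun n => hA _
  rw [e1] at h
  simp only [Nat.cast_zero, add_zero] at h
  unfold lam
  rw [h]
  rfl

lemma rev_pos {A : ℤ → ℕ} (hA : ∀ n, 0 < A n) (n : ℤ) : 0 < rev A n := hA _

lemma lam_rev {A : ℤ → ℕ} (hA : ∀ n, 0 < A n) (i : ℤ) : lam (rev A) i = lam A (-i) := by
  rw [lam_eq hA, lam_eq (rev_pos hA), lseq_rev, rseq_rev]
  simp only [rev]; ring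

/-! ### Rational bounds from finite windows -/

/-- `mob w (p.1 / p.2)` as a fraction of natural numbers. -/
def frac (w : List ℕ) (p : ℕ × ℕ) : ℕ × ℕ := w.foldr (fun a p => (p.2, a * p.2 + p.1)) p

lemma frac_spec {w : List ℕ} (hw : ∀ d ∈ w, 0 < d) {p : ℕ × ℕ} (hp : 0 < p.2) :
    0 < (frac w p).2 ∧ mob w ((p.1 : ℝ) / p.2) = ((frac w p).1 : ℝ) / (frac w p).2 := by
  induction w with
  | nil => exact ⟨hp, rfl⟩
  | cons d w ih =>
    obtain ⟨h1, h2⟩ := ih fun d hd => hw d (by simp [hd])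
    have hd : 0 < d := hw d (by simp)
    change 0 < d * (frac w p).2 + (frac w p).1 ∧ 1 / ((d : ℝ) + mob w ((p.1 : ℝ) / p.2)) =
      ((frac w p).2 : ℝ) / ((d * (frac w p).2 + (frac w p).1 : ℕ) : ℝ)
    refine ⟨by positivity, ?_⟩
    rw [h2]
    have h1' : (0 : ℝ) < (frac w p).2 := by exact_mod_cast h1
    push_cast
    field_simp

/-- Lower bound for `[0; w, g]` with `g` in `{1,2}`. -/
def loFr (w : List ℕ) : ℕ × ℕ := if w.length % 2 = 0 then frac w (1, 3) else frac w (3, 4)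

/-- Upper bound for `[0; w, g]` with `g` in `{1,2}`. -/
def hiFr (w : List ℕ) : ℕ × ℕ := if w.length % 2 = 0 then frac w (3, 4) else frac w (1, 3)

lemma loFr_pos {w : List ℕ} (hw : ∀ d ∈ w, 0 < d) : 0 < (loFr w).2 := by
  unfold loFr; split_ifs
  exacts [(frac_spec hw (by norm_num)).1, (frac_spec hw (by norm_num)).1]

lemma hiFr_pos {w : List ℕ} (hw : ∀ d ∈ w, 0 < d) : 0 < (hiFr w).2 := by
  unfold hiFr; split_ifs
  exacts [(frac_spec hw (by norm_num)).1, (frac_spec hw (by norm_num)).1]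

lemma loFr_le_mob {w : List ℕ} (hw : ∀ d ∈ w, 0 < d) {t : ℝ} (h1 : 1 / 3 ≤ t) (h2 : t ≤ 3 / 4) :
    ((loFr w).1 : ℝ) / (loFr w).2 ≤ mob w t := by
  unfold loFr
  split_ifs with h
  · rw [← (frac_spec hw (p := (1, 3)) (by norm_num)).2]
    have := mob_mono hw (by norm_num) h1
    rw [if_pos h] at this
    simpa using this
  · rw [← (frac_spec hw (p := (3, 4)) (by norm_num)).2]
    have := mob_mono hw (by linarith) h2
    rw [if_neg h] at this
    simpa using this

lemma mob_le_hiFr {w : List ℕ} (hw : ∀ d ∈ w, 0 < d) {t : ℝ} (h1 : 1 / 3 ≤ t) (h2 : t ≤ 3 / 4) :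
    mob w t ≤ ((hiFr w).1 : ℝ) / (hiFr w).2 := by
  unfold hiFr
  split_ifs with h
  · rw [← (frac_spec hw (p := (3, 4)) (by norm_num)).2]
    have := mob_mono hw (by linarith) h2
    rw [if_pos h] at this
    simpa using this
  · rw [← (frac_spec hw (p := (1, 3)) (by norm_num)).2]
    have := mob_mono hw (by norm_num) h1
    rw [if_neg h] at this
    simpa using this

lemma loFr_le_cf0 {g : ℕ → ℕ} (hg : ∀ n, 0 < g n) {n : ℕ} (h0 : g n ≤ 2) (h1 : g (n + 1) ≤ 2) :
    ((loFr (pre g n)).1 : ℝ) / (loFr (pre g n)).2 ≤ cf0 g := by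
  rw [cf0_eq_mob hg n]
  exact loFr_le_mob (pos_of_mem_pre hg n) (third_le_cf0 (fun _ => hg _) h0)
    (cf0_le_three_quarters (fun _ => hg _) h1)

lemma cf0_le_hiFr {g : ℕ → ℕ} (hg : ∀ n, 0 < g n) {n : ℕ} (h0 : g n ≤ 2) (h1 : g (n + 1) ≤ 2) :
    cf0 g ≤ ((hiFr (pre g n)).1 : ℝ) / (hiFr (pre g n)).2 := by
  rw [cf0_eq_mob hg n]
  exact mob_le_hiFr (pos_of_mem_pre hg n) (third_le_cf0 (fun _ => hg _) h0)
    (cf0_le_three_quarters (fun _ => hg _) h1)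

/-- The test `2 + [0; l, …] + [0; r, …] < N / 10 ^ 22`. -/
def below (N : ℕ) (l r : List ℕ) : Bool :=
  decide ((2 * (hiFr l).2 * (hiFr r).2 + (hiFr l).1 * (hiFr r).2 + (hiFr r).1 * (hiFr l).2)
    * 10 ^ 22 < N * ((hiFr l).2 * (hiFr r).2))

/-- The test `N / 10 ^ 22 < 2 + [0; l, …] + [0; r, …]`. -/
def above (N : ℕ) (l r : List ℕ) : Bool :=
  decide (N * ((loFr l).2 * (loFr r).2) <
    (2 * (loFr l).2 * (loFr r).2 + (loFr l).1 * (loFr r).2 + (loFr r).1 * (loFr l).2) * 10 ^ 22)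

lemma lt_of_below {N : ℕ} {g h : ℕ → ℕ} (hg : ∀ n, 0 < g n) (hh : ∀ n, 0 < h n) {m n : ℕ}
    (hb : below N (pre g m) (pre h n) = true) (g0 : g m ≤ 2) (g1 : g (m + 1) ≤ 2)
    (h0 : h n ≤ 2) (h1 : h (n + 1) ≤ 2) : 2 + cf0 g + cf0 h < N / 10 ^ 22 := by
  have e1 := cf0_le_hiFr hg g0 g1
  have e2 := cf0_le_hiFr hh h0 h1
  have p1 : (0 : ℝ) < (hiFr (pre g m)).2 := by exact_mod_cast hiFr_pos (pos_of_mem_pre hg m)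
  have p2 : (0 : ℝ) < (hiFr (pre h n)).2 := by exact_mod_cast hiFr_pos (pos_of_mem_pre hh n)
  simp only [below, decide_eq_true_eq] at hb
  rify at hb
  have e3 : 2 + ((hiFr (pre g m)).1 : ℝ) / (hiFr (pre g m)).2
      + ((hiFr (pre h n)).1 : ℝ) / (hiFr (pre h n)).2 < N / 10 ^ 22 := by
    have p3 := mul_pos p1 p2
    rw [lt_div_iff₀ (by norm_num)]
    rw [← mul_lt_mul_iff_left₀ p3]
    calc _ = _ := by field_simp
      _ < _ := hb
      _ = _ := by ring
  linarith

lemma lt_of_above {N : ℕ} {g h : ℕ → ℕ} (hg : ∀ n, 0 < g n) (hh : ∀ n, 0 < h n) {m n : ℕ}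
    (hb : above N (pre g m) (pre h n) = true) (g0 : g m ≤ 2) (g1 : g (m + 1) ≤ 2)
    (h0 : h n ≤ 2) (h1 : h (n + 1) ≤ 2) : N / 10 ^ 22 < 2 + cf0 g + cf0 h := by
  have e1 := loFr_le_cf0 hg g0 g1
  have e2 := loFr_le_cf0 hh h0 h1
  have p1 : (0 : ℝ) < (loFr (pre g m)).2 := by exact_mod_cast loFr_pos (pos_of_mem_pre hg m)
  have p2 : (0 : ℝ) < (loFr (pre h n)).2 := by exact_mod_cast loFr_pos (pos_of_mem_pre hh n)
  simp only [above, decide_eq_true_eq] at hb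
  rify at hb
  have e3 : N / 10 ^ 22 < 2 + ((loFr (pre g m)).1 : ℝ) / (loFr (pre g m)).2
      + ((loFr (pre h n)).1 : ℝ) / (loFr (pre h n)).2 := by
    have p3 := mul_pos p1 p2
    rw [div_lt_iff₀ (by norm_num)]
    rw [← mul_lt_mul_iff_left₀ p3]
    calc _ = _ := by ring
      _ < _ := hb
      _ = _ := by field_simp
  linarith

/-! ### The two ends of the interval -/

/-- The nine-periodic digits to the left of a special position, read outwards. -/
def lper : ℕ → ℕ := perSeq [2, 2, 2, 1, 1, 2, 2, 1, 2]

/-- The nine-periodic digits to the right of a special position, read outwards. -/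
def rper : ℕ → ℕ := perSeq [1, 2, 2, 1, 1, 2, 2, 2, 2]

lemma perSeq_mem {w : List ℕ} (hw : ∀ d ∈ w, d = 1 ∨ d = 2) (n : ℕ) :
    perSeq w n = 1 ∨ perSeq w n = 2 := by
  unfold perSeq
  rcases lt_or_ge (n % w.length) w.length with h | h
  · rw [List.getD_eq_getElem _ _ h]
    exact hw _ (List.getElem_mem h)
  · rw [List.getD_eq_default _ _ h]
    exact Or.inl rfl

lemma catSeq_mem {w : List ℕ} (hw : ∀ d ∈ w, d = 1 ∨ d = 2) {g : ℕ → ℕ}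
    (hg : ∀ n, g n = 1 ∨ g n = 2) (n : ℕ) : catSeq w g n = 1 ∨ catSeq w g n = 2 := by
  unfold catSeq
  split_ifs with h
  · rw [List.getD_eq_getElem _ _ h]
    exact hw _ (List.getElem_mem h)
  · exact hg _

lemma pos_of_mem {g : ℕ → ℕ} (hg : ∀ n, g n = 1 ∨ g n = 2) (n : ℕ) : 0 < g n := by
  rcases hg n with h | h <;> omega

lemma le_two_of_mem {g : ℕ → ℕ} (hg : ∀ n, g n = 1 ∨ g n = 2) (n : ℕ) : g n ≤ 2 := by
  rcases hg n with h | h <;> omega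

lemma lper_mem (n : ℕ) : lper n = 1 ∨ lper n = 2 := perSeq_mem (by decide) n

lemma rper_mem (n : ℕ) : rper n = 1 ∨ rper n = 2 := perSeq_mem (by decide) n

lemma lper_add (n q : ℕ) : lper (n + 9 * q) = lper n := by
  simp [lper, perSeq]

lemma rper_add (n q : ℕ) : rper (n + 9 * q) = rper n := by
  simp [rper, perSeq]

lemma cInf_eq : cInf = 2 + cf0 lper + cf0 rper := by
  unfold cInf
  rw [cfVal_eq_add_cf0 fun n => pos_of_mem (perSeq_mem (by decide)) (n + 1)]
  have e : (fun n => perSeq [2, 2, 2, 2, 1, 1, 2, 2, 1] (n + 1)) = lper := by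
    funext n
    simp only [perSeq, lper, List.length_cons, List.length_nil, zero_add, Nat.reduceAdd]
    have h : n % 9 < 9 := Nat.mod_lt _ (by norm_num)
    rw [Nat.add_mod]
    generalize n % 9 = k at h
    interval_cases k <;> rfl
  rw [e]
  rfl

/-- The extremal tail. -/
def tper : ℕ → ℕ := perSeq [2, 2, 2, 1, 1, 1]

lemma tper_mem (n : ℕ) : tper n = 1 ∨ tper n = 2 := perSeq_mem (by decide) n

/-- The outward reading of the left half of the sequence of Markov value `CInf`, before its
periodic part. -/
def extL : List ℕ := [2, 2, 2, 1, 1, 2, 2, 1, 2, 2, 2, 2, 1, 1, 1, 1]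

/-- The right half of the sequence of Markov value `CInf`, before its periodic part. -/
def extR : List ℕ :=
  [1, 2, 2, 1, 1, 2, 2, 2, 2, 1, 2, 2, 1, 1, 2, 2, 2, 2, 1, 2, 2, 1, 1, 2, 2, 1, 2, 2, 2, 2, 1, 1]

lemma CInf_eq : CInf = 2 + cf0 (catSeq extL tper) + cf0 (catSeq extR tper) := by
  have h := cfVal_eq_add_cf0
    (a := prePer [2,1,2,2,1,1,2,2,2,2,1,2,2,1,1,2,2,2,2,1,2,2,1,1,2,2,1,2,2,2,2,1,1] [2,2,2,1,1,1])
    fun n => pos_of_mem (catSeq_mem (by decide) (perSeq_mem (by decide))) (n + 1)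
  unfold CInf
  rw [h]
  have e1 : (fun n => prePer [2,1,2,2,1,1,2,2,2,2,1,2,2,1,1,2,2,2,2,1,2,2,1,1,2,2,1,2,2,2,2,1,1]
      [2,2,2,1,1,1] (n + 1)) = catSeq extR tper := by
    funext n
    simp only [prePer, catSeq, extR, tper, List.length_cons, List.length_nil, zero_add,
      Nat.reduceAdd]
    split_ifs with h h' h'
    · rfl
    · omega
    · omega
    · congr 1
  have e2 : prePer [2,2,2,1,1,2,2,1,2,2,2,2,1] [1,1,1,2,2,2] = catSeq extL tper := by
    funext n
    simp only [prePer, catSeq, extL, tper, List.length_cons, List.length_nil, zero_add,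
      Nat.reduceAdd]
    split_ifs with h h' h'
    · interval_cases n <;> rfl
    · omega
    · interval_cases n <;> rfl
    · obtain ⟨k, rfl⟩ := Nat.exists_eq_add_of_le (show 16 ≤ n by omega)
      simp only [perSeq, List.length_cons, List.length_nil, zero_add, Nat.reduceAdd]
      rw [show 16 + k - 13 = k + 3 by omega, show 16 + k - 16 = k by omega, Nat.add_mod]
      have h : k % 6 < 6 := Nat.mod_lt _ (by norm_num)
      generalize k % 6 = j at h
      interval_cases j <;> rfl
  rw [e1, e2]
  simp only [prePer, catSeq, List.length_cons]
  norm_num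
  ring

lemma cInf_bounds : (31181201781436986002148 : ℝ) / 10 ^ 22 < cInf ∧
    cInf < 31181201781436986002149 / 10 ^ 22 := by
  have hl := fun n => pos_of_mem lper_mem n
  have hr := fun n => pos_of_mem rper_mem n
  have hl' := fun n => le_two_of_mem lper_mem n
  have hr' := fun n => le_two_of_mem rper_mem n
  rw [cInf_eq]
  refine ⟨?_, ?_⟩
  · exact_mod_cast lt_of_above (N := 31181201781436986002148) (m := 50) (n := 50) hl hr
      (by decide +kernel) (hl' _) (hl' _) (hr' _) (hr' _)
  · exact_mod_cast lt_of_below (N := 31181201781436986002149) (m := 50) (n := 50) hl hr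
      (by decide +kernel) (hl' _) (hl' _) (hr' _) (hr' _)

lemma CInf_bounds : (31181201783287460160927 : ℝ) / 10 ^ 22 < CInf ∧
    CInf < 31181201783287460160928 / 10 ^ 22 := by
  have ml := catSeq_mem (w := extL) (by decide) tper_mem
  have mr := catSeq_mem (w := extR) (by decide) tper_mem
  have hl := fun n => pos_of_mem ml n
  have hr := fun n => pos_of_mem mr n
  have hl' := fun n => le_two_of_mem ml n
  have hr' := fun n => le_two_of_mem mr n
  rw [CInf_eq]
  refine ⟨?_, ?_⟩
  · exact_mod_cast lt_of_above (N := 31181201783287460160927) (m := 60) (n := 60) hl hr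
      (by decide +kernel) (hl' _) (hl' _) (hr' _) (hr' _)
  · exact_mod_cast lt_of_below (N := 31181201783287460160928) (m := 60) (n := 60) hl hr
      (by decide +kernel) (hl' _) (hl' _) (hr' _) (hr' _)

/-! ### Exhaustive search for windows around a position -/

/-- All digits of `A` on `[lo, hi]` are `1` or `2`. -/
def Dig (A : ℤ → ℕ) (lo hi : ℤ) : Prop := ∀ n, lo ≤ n → n ≤ hi → A n = 1 ∨ A n = 2

/-- No word of `F` occurs in `A` within `[lo, hi]`. -/
def Free (F : List (List ℕ)) (A : ℤ → ℕ) (lo hi : ℤ) : Prop :=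
  ∀ w ∈ F, ∀ s : ℤ, lo ≤ s → s + w.length ≤ hi + 1 → ¬ occursAtZ w A s

lemma Dig.mono {A : ℤ → ℕ} {lo hi lo' hi' : ℤ} (h : Dig A lo hi) (h1 : lo ≤ lo') (h2 : hi' ≤ hi) :
    Dig A lo' hi' := fun n hn hn' => h n (h1.trans hn) (hn'.trans h2)

lemma Free.mono {F : List (List ℕ)} {A : ℤ → ℕ} {lo hi lo' hi' : ℤ} (h : Free F A lo hi)
    (h1 : lo ≤ lo') (h2 : hi' ≤ hi) : Free F A lo' hi' :=
  fun w hw s hs hs' => h w hw s (h1.trans hs) (by omega)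

lemma Dig.reversed {A : ℤ → ℕ} {lo hi : ℤ} (h : Dig A lo hi) : Dig (rev A) (-hi) (-lo) :=
  fun n hn hn' => h (-n) (by omega) (by omega)

lemma occursAtZ_rev {w : List ℕ} {A : ℤ → ℕ} {s : ℤ} (h : occursAtZ w (rev A) s) :
    occursAtZ w.reverse A (1 - s - w.length) := by
  intro i hi
  rw [List.length_reverse] at hi
  have h1 := h (w.length - 1 - i) (by omega)
  rw [List.getD_eq_getElem _ _ (by simpa using hi), List.getElem_reverse,
    ← List.getD_eq_getElem _ 0, ← h1]
  simp only [rev]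
  congr 1
  omega

lemma Free.reversed {F : List (List ℕ)} (hF : ∀ w ∈ F, w.reverse ∈ F) {A : ℤ → ℕ} {lo hi : ℤ}
    (h : Free F A lo hi) : Free F (rev A) (-hi) (-lo) := by
  intro w hw s hs hs' ho
  exact h _ (hF w hw) _ (by omega) (by rw [List.length_reverse]; omega) (occursAtZ_rev ho)

/-- Some word of `F` is a consecutive subword of `l`. -/
def containsWord (F : List (List ℕ)) (l : List ℕ) : Bool :=
  F.any fun w => l.tails.any fun t => w.isPrefixOf t

lemma exists_of_containsWord {F : List (List ℕ)} {l : List ℕ} (h : containsWord F l = true) :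
    ∃ w ∈ F, ∃ u v, l = u ++ (w ++ v) := by
  simp only [containsWord, List.any_eq_true, List.mem_tails, List.isPrefixOf_iff_prefix] at h
  obtain ⟨w, hw, t, ⟨u, rfl⟩, ⟨v, rfl⟩⟩ := h
  exact ⟨w, hw, u, v, rfl⟩

lemma occursAtZ_of_pre_eq {A : ℤ → ℕ} {a : ℤ} {n : ℕ} {u w v : List ℕ}
    (h : pre (fun k => A (a + k)) n = u ++ (w ++ v)) : occursAtZ w A (a + u.length) := by
  have hl := congrArg List.length h
  simp only [length_pre, List.length_append] at hl
  intro i hi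
  have := getD_of_pre_eq h (k := u.length + i) (by omega) 0
  rw [List.getD_append_right _ _ _ _ (by omega), Nat.add_sub_cancel_left,
    List.getD_append _ _ _ _ hi] at this
  rw [← this]
  push_cast
  congr 1; ring

lemma reverse_pre_lseq (A : ℤ → ℕ) (i : ℤ) (m : ℕ) :
    (pre (lseq A i) m).reverse = pre (fun k => A (i - m + k)) m := by
  induction m with
  | zero => rfl
  | succ m ih =>
    rw [pre_succ, List.reverse_append, ih, pre_succ']
    simp only [List.reverse_cons, List.reverse_nil, List.nil_append, List.cons_append, lseq]
    congr 2
    · push_cast; ring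
    · funext k; congr 1; push_cast; ring

lemma window_eq (A : ℤ → ℕ) (i : ℤ) (m n : ℕ) :
    (pre (lseq A i) m).reverse ++ A i :: pre (rseq A i) n
      = pre (fun k => A (i - m + k)) (m + (n + 1)) := by
  rw [pre_add, reverse_pre_lseq, pre_succ']
  congr 2
  · congr 1; push_cast; ring
  · refine congrArg (fun f => pre f n) ?_
    funext k; simp only [rseq]; congr 1; push_cast; ring

/-- Every way of extending the window `l.reverse ++ 2 :: r` with digits `1` and `2` either meets a
word of `F` or satisfies `halt`, within `f` steps. -/
def grow (F : List (List ℕ)) (halt : List ℕ → List ℕ → Bool) : ℕ → List ℕ → List ℕ → Bool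
  | 0, _, _ => false
  | f + 1, l, r => containsWord F (l.reverse ++ 2 :: r) || (halt l r ||
      if l.length ≤ r.length then grow F halt f (l ++ [1]) r && grow F halt f (l ++ [2]) r
      else grow F halt f l (r ++ [1]) && grow F halt f l (r ++ [2]))

lemma grow_sound {F : List (List ℕ)} {halt : List ℕ → List ℕ → Bool} {A : ℤ → ℕ} {i : ℤ}
    (hi : A i = 2) {K f m n : ℕ} (hD : Dig A (i - K) (i + K)) (hF : Free F A (i - K) (i + K))
    (h : grow F halt f (pre (lseq A i) m) (pre (rseq A i) n) = true)
    (hm : m + f ≤ K) (hn : n + f ≤ K) :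
    ∃ m' n', m' + 1 ≤ m + f ∧ n' + 1 ≤ n + f ∧
      halt (pre (lseq A i) m') (pre (rseq A i) n') = true := by
  induction f generalizing m n with
  | zero => simp [grow] at h
  | succ f ih =>
    rw [grow, Bool.or_eq_true, Bool.or_eq_true] at h
    rcases h with h | h | h
    · exfalso
      obtain ⟨w, hw, u, v, e⟩ := exists_of_containsWord h
      rw [← hi, window_eq] at e
      have hl := congrArg List.length e
      simp only [length_pre, List.length_append] at hl
      exact hF w hw _ (by omega) (by omega) (occursAtZ_of_pre_eq e)
    · exact ⟨m, n, by omega, by omega, h⟩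
    · split_ifs at h with hc
      · rw [Bool.and_eq_true] at h
        have hd : lseq A i m = 1 ∨ lseq A i m = 2 := hD _ (by omega) (by omega)
        have h' : grow F halt f (pre (lseq A i) (m + 1)) (pre (rseq A i) n) = true := by
          rw [pre_succ]
          rcases hd with e | e <;> rw [e]
          exacts [h.1, h.2]
        obtain ⟨m', n', h1, h2, h3⟩ := ih h' (by omega) (by omega)
        exact ⟨m', n', by omega, by omega, h3⟩
      · rw [Bool.and_eq_true] at h
        have hd : rseq A i n = 1 ∨ rseq A i n = 2 := hD _ (by omega) (by omega)
        have h' : grow F halt f (pre (lseq A i) m) (pre (rseq A i) (n + 1)) = true := by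
          rw [pre_succ]
          rcases hd with e | e <;> rw [e]
          exacts [h.1, h.2]
        obtain ⟨m', n', h1, h2, h3⟩ := ih h' (by omega) (by omega)
        exact ⟨m', n', by omega, by omega, h3⟩

lemma lseq_pos {A : ℤ → ℕ} (hA : ∀ n, 0 < A n) (i : ℤ) (n : ℕ) : 0 < lseq A i n := hA _

lemma rseq_pos {A : ℤ → ℕ} (hA : ∀ n, 0 < A n) (i : ℤ) (n : ℕ) : 0 < rseq A i n := hA _

lemma Dig.lseq {A : ℤ → ℕ} {i : ℤ} {K n : ℕ} (h : Dig A (i - K) (i + K)) (hn : n + 1 ≤ K) :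
    lseq A i n ≤ 2 := by
  have : A (i - 1 - n) = 1 ∨ A (i - 1 - n) = 2 := h _ (by omega) (by omega)
  unfold _root_.lseq
  omega

lemma Dig.rseq {A : ℤ → ℕ} {i : ℤ} {K n : ℕ} (h : Dig A (i - K) (i + K)) (hn : n + 1 ≤ K) :
    rseq A i n ≤ 2 := by
  have : A (i + 1 + n) = 1 ∨ A (i + 1 + n) = 2 := h _ (by omega) (by omega)
  unfold _root_.rseq
  omega

lemma lt_lam_of_above {A : ℤ → ℕ} (hA : ∀ n, 0 < A n) {i : ℤ} (hi : A i = 2) {K m n N : ℕ}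
    (hD : Dig A (i - K) (i + K)) (hm : m + 2 ≤ K) (hn : n + 2 ≤ K)
    (h : above N (pre (lseq A i) m) (pre (rseq A i) n) = true) : N / 10 ^ 22 < lam A i := by
  have := lt_of_above (lseq_pos hA i) (rseq_pos hA i) h (hD.lseq (by omega)) (hD.lseq (by omega))
    (hD.rseq (by omega)) (hD.rseq (by omega))
  rw [lam_eq hA, hi]
  push_cast
  linarith

lemma lam_lt_of_below {A : ℤ → ℕ} (hA : ∀ n, 0 < A n) {i : ℤ} (hi : A i = 2) {K m n N : ℕ}
    (hD : Dig A (i - K) (i + K)) (hm : m + 2 ≤ K) (hn : n + 2 ≤ K)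
    (h : below N (pre (lseq A i) m) (pre (rseq A i) n) = true) : lam A i < N / 10 ^ 22 := by
  have := lt_of_below (lseq_pos hA i) (rseq_pos hA i) h (hD.lseq (by omega)) (hD.lseq (by omega))
    (hD.rseq (by omega)) (hD.rseq (by omega))
  rw [lam_eq hA, hi]
  push_cast
  linarith

lemma windows_of_occursAtZ {w : List ℕ} {A : ℤ → ℕ} {s : ℤ} (h : occursAtZ w A s) {c : ℕ}
    (hc : c < w.length) :
    A (s + c) = w.getD c 0 ∧ pre (lseq A (s + c)) c = (w.take c).reverse ∧
      pre (rseq A (s + c)) (w.length - 1 - c) = w.drop (c + 1) := by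
  refine ⟨h c hc, ?_, ?_⟩
  · refine List.ext_getElem (by simp; omega) fun k h1 h2 => ?_
    rw [length_pre] at h1
    rw [getElem_pre, List.getElem_reverse, List.getElem_take, ← List.getD_eq_getElem _ 0, ← h _ ?_]
    · simp only [lseq, List.length_take]; congr 1; omega
    · simp only [List.length_take]; omega
  · refine List.ext_getElem (by simp; omega) fun k h1 h2 => ?_
    rw [length_pre] at h1
    rw [getElem_pre, List.getElem_drop, ← List.getD_eq_getElem _ 0, ← h _ (by omega)]
    simp only [rseq]; congr 1; push_cast; ring

lemma not_occursAtZ_of_grow {F : List (List ℕ)} {A : ℤ → ℕ} (hA : ∀ n, 0 < A n) {w : List ℕ}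
    {c f K N : ℕ} {s : ℤ} (hc : c < w.length) (hw : w.getD c 0 = 2)
    (hg : grow F (above N) f (w.take c).reverse (w.drop (c + 1)) = true)
    (hD : Dig A (s + c - K) (s + c + K)) (hF : Free F A (s + c - K) (s + c + K))
    (hK : w.length + f + 1 ≤ K) (hl : lam A (s + c) ≤ N / 10 ^ 22) : ¬ occursAtZ w A s := by
  intro ho
  obtain ⟨h0, h1, h2⟩ := windows_of_occursAtZ ho hc
  rw [hw] at h0
  rw [← h1, ← h2] at hg
  obtain ⟨m, n, hm, hn, h⟩ := grow_sound h0 hD hF hg (by omega) (by omega)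
  exact absurd (lt_lam_of_above hA h0 hD (by omega) (by omega) h) (not_lt.2 hl)

/-! ### Words forced by an upper bound on the Markov value -/

/-- The words `W_1, …, W_13` and their transposes. -/
def FW : List (List ℕ) := Wall ++ Wall.map List.reverse

/-- The words `W_1, …, W_13` except `W_9`. -/
def Wmost : List (List ℕ) := Wall.filter (· ≠ W9)

lemma FW_reverse : ∀ w ∈ FW, w.reverse ∈ FW := by decide +kernel

lemma Free.append_reverse {F : List (List ℕ)} {A : ℤ → ℕ} {lo hi : ℤ} (h : Free F A lo hi)
    (h' : Free F (rev A) (-hi) (-lo)) : Free (F ++ F.map List.reverse) A lo hi := by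
  intro w hw s hs hs' ho
  rcases List.mem_append.1 hw with hw | hw
  · exact h w hw s hs hs' ho
  · obtain ⟨v, hv, rfl⟩ := List.mem_map.1 hw
    rw [← rev_rev A] at ho
    have := occursAtZ_rev ho
    rw [List.reverse_reverse] at this
    rw [List.length_reverse] at this hs'
    exact h' v hv _ (by omega) (by omega) this

lemma free_Wmost {A : ℤ → ℕ} (hA : ∀ n, 0 < A n) {lo hi : ℤ} (hD : Dig A lo hi)
    (hl : ∀ j, lo ≤ j → j ≤ hi → lam A j ≤ CInf) : Free Wmost A (lo + 40) (hi - 40) := by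
  have key : ∀ w ∈ Wmost, ∃ c, c < w.length ∧ w.length ≤ 31 ∧ w.getD c 0 = 2 ∧
      grow [] (above 31181201783287460160928) 1 (w.take c).reverse (w.drop (c + 1)) = true := by
    have h : ∀ w ∈ Wmost, ∃ c < 31, c < w.length ∧ w.length ≤ 31 ∧ w.getD c 0 = 2 ∧
      grow [] (above 31181201783287460160928) 1 (w.take c).reverse (w.drop (c + 1)) = true := by
      decide +kernel
    intro w hw
    obtain ⟨c, -, hc⟩ := h w hw
    exact ⟨c, hc⟩
  intro w hw s hs hs'
  obtain ⟨c, h1, h2, h3, h4⟩ := key w hw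
  refine not_occursAtZ_of_grow (K := 33) hA h1 h3 h4 (hD.mono (by omega) (by omega)) ?_
    (by omega) ?_
  · intro w hw; simp at hw
  · have := hl (s + c) (by omega) (by omega)
    have := CInf_bounds.2
    push_cast
    linarith

lemma free_W9 {A : ℤ → ℕ} (hA : ∀ n, 0 < A n) {lo hi : ℤ} (hD : Dig A lo hi)
    (hF : Free (Wmost ++ Wmost.map List.reverse) A lo hi)
    (hl : ∀ j, lo ≤ j → j ≤ hi → lam A j ≤ CInf) : Free [W9] A (lo + 40) (hi - 40) := by
  intro w hw s hs hs'
  rw [List.mem_singleton] at hw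
  subst hw
  have hlen : W9.length = 22 := rfl
  refine not_occursAtZ_of_grow (K := 36) (c := 11) (f := 12) (N := 31181201783287460160928) hA
    (by decide) (by decide) (by decide +kernel) (hD.mono ?_ ?_) (hF.mono ?_ ?_) (by decide) ?_
  any_goals omega
  have := hl (s + 11) (by omega) (by omega)
  have := CInf_bounds.2
  push_cast
  linarith

lemma free_FW {A : ℤ → ℕ} (hA : ∀ n, 0 < A n) {lo hi : ℤ} (hD : Dig A lo hi)
    (hl : ∀ j, lo ≤ j → j ≤ hi → lam A j ≤ CInf) : Free FW A (lo + 80) (hi - 80) := by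
  have hl' : ∀ j, -hi ≤ j → j ≤ -lo → lam (rev A) j ≤ CInf := fun j h1 h2 => by
    rw [lam_rev hA]; exact hl _ (by omega) (by omega)
  have m1 := (free_Wmost hA hD hl).append_reverse
    ((free_Wmost (rev_pos hA) hD.reversed hl').mono (by omega) (by omega))
  have m2 : Free (Wmost ++ Wmost.map List.reverse) (rev A) (-(hi - 40)) (-(lo + 40)) :=
    m1.reversed (by decide +kernel)
  have m3 := (free_W9 hA (hD.mono (by omega) (by omega)) m1
    fun j h1 h2 => hl j (by omega) (by omega)).append_reverse
    ((free_W9 (rev_pos hA) (hD.reversed.mono (by omega) (by omega)) m2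
      fun j h1 h2 => hl' j (by omega) (by omega)).mono (by omega) (by omega))
  have cover : ∀ w ∈ FW, w ∈ Wmost ++ Wmost.map List.reverse ∨
      w ∈ [W9] ++ [W9].map List.reverse := by
    decide +kernel
  intro w hw s hs hs'
  rcases cover w hw with h | h
  · exact m1 w h s (by omega) (by omega)
  · exact m3 w h s (by omega) (by omega)

/-! ### Special positions -/

/-- The position `i` is the marked digit of an occurrence of `2 1_2 2_3 2^* 1 2_2 1_2 2_3`. -/
def Sp (A : ℤ → ℕ) (i : ℤ) : Prop :=
  A i = 2 ∧ pre (lseq A i) 6 = [2, 2, 2, 1, 1, 2] ∧ pre (rseq A i) 8 = [1, 2, 2, 1, 1, 2, 2, 2]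

/-- The test for special positions. -/
def spTest (l r : List ℕ) : Bool :=
  [2, 2, 2, 1, 1, 2].isPrefixOf l && [1, 2, 2, 1, 1, 2, 2, 2].isPrefixOf r

lemma pre_of_isPrefixOf {w : List ℕ} {g : ℕ → ℕ} {m : ℕ} (h : w.isPrefixOf (pre g m) = true) :
    pre g w.length = w := by
  obtain ⟨v, hv⟩ := List.isPrefixOf_iff_prefix.1 h
  have hl := congrArg List.length hv
  rw [length_pre, List.length_append] at hl
  subst hl
  rw [pre_add] at hv
  exact (List.append_inj_left hv (by simp)).symm

lemma sp_of_spTest {A : ℤ → ℕ} {i : ℤ} (hi : A i = 2) {m n : ℕ}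
    (h : spTest (pre (lseq A i) m) (pre (rseq A i) n) = true) : Sp A i := by
  rw [spTest, Bool.and_eq_true] at h
  exact ⟨hi, pre_of_isPrefixOf h.1, pre_of_isPrefixOf h.2⟩

lemma lam_lt_or_sp {A : ℤ → ℕ} (hA : ∀ n, 0 < A n) {i : ℤ} (hD : Dig A (i - 60) (i + 60))
    (hF : Free FW A (i - 60) (i + 60)) :
    lam A i < 31181201781436986002148 / 10 ^ 22 ∨ Sp A i ∨ Sp (rev A) (-i) := by
  rcases hD i (by omega) (by omega) with hi | hi
  · left
    have h1 := cf0_le_one (lseq_pos hA i)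
    have h2 := cf0_le_one (rseq_pos hA i)
    rw [lam_eq hA, hi]
    norm_num
    linarith
  · have hg : grow FW (fun l r => below 31181201781436986002148 l r || (spTest l r || spTest r l))
        50 (pre (lseq A i) 0) (pre (rseq A i) 0) = true := by
      rw [pre_zero, pre_zero]; decide +kernel
    obtain ⟨m, n, hm, hn, h⟩ := grow_sound hi (K := 60) hD hF hg (by omega) (by omega)
    rw [Bool.or_eq_true, Bool.or_eq_true] at h
    rcases h with h | h | h
    · left
      exact_mod_cast lam_lt_of_below (K := 60) hA hi hD (by omega) (by omega) h
    · exact Or.inr (Or.inl (sp_of_spTest hi h))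
    · refine Or.inr (Or.inr (sp_of_spTest (m := n) (n := m) (by simpa [rev] using hi) ?_))
      rw [lseq_rev, rseq_rev, neg_neg]
      exact h

/-! ### The extremal tail -/

lemma cf0_catSeq {w : List ℕ} (hw : ∀ d ∈ w, 0 < d) {g : ℕ → ℕ} (hg : ∀ n, 0 < g n) :
    cf0 (catSeq w g) = mob w (cf0 g) := by
  have hc : ∀ n, 0 < catSeq w g n := by
    intro n
    unfold catSeq
    split_ifs with h
    · rw [List.getD_eq_getElem _ _ h]
      exact hw _ (List.getElem_mem h)
    · exact hg _
  rw [cf0_eq_mob hc w.length]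
  have e1 : pre (catSeq w g) w.length = w := by
    refine List.ext_getElem (by simp) fun k h1 h2 => ?_
    rw [getElem_pre, catSeq, if_pos h2, List.getD_eq_getElem _ _ h2]
  have e2 : (fun k => catSeq w g (w.length + k)) = g := by
    funext k; simp [catSeq]
  rw [e1, e2]

lemma mob_sub_le {w : List ℕ} (he : w.length % 2 = 0) (hw : ∀ d ∈ w, 0 < d) {s t e : ℝ}
    (hs : 0 ≤ s) (ht : 0 ≤ t) (he' : 0 ≤ e) (h : s - e ≤ t) :
    mob w s - (1 / 4) ^ (w.length / 2) * e ≤ mob w t := by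
  have h4 : (0 : ℝ) ≤ (1 / 4) ^ (w.length / 2) := by positivity
  rcases le_total s t with hst | hst
  · have := mob_mono hw hs hst
    rw [if_pos he] at this
    have := mul_nonneg h4 he'
    linarith
  · have h1 := abs_mob_sub_le_pow (w.length / 2) (by omega) hw hs ht
    have h2 := le_abs_self (mob w s - mob w t)
    rw [abs_of_nonneg (sub_nonneg.2 hst)] at h1
    have := mul_le_mul_of_nonneg_left (show s - t ≤ e by linarith) h4
    linarith

lemma cf0_tper : cf0 tper = mob [2, 2, 2, 1, 1, 1] (cf0 tper) := by
  have h := cf0_eq_mob (fun n => pos_of_mem tper_mem n) 6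
  have e : (fun k => tper (6 + k)) = tper := by
    funext k; simp [tper, perSeq]
  rw [e] at h
  exact h

lemma cf0_tper_le_of_pre {h : ℕ → ℕ} (hpos : ∀ n, 0 < h n) {w : List ℕ} {m : ℕ}
    (hw : pre h m = w) (h0 : h m ≤ 2) (h1 : h (m + 1) ≤ 2)
    (hc : (hiFr (pre tper 12)).1 * (loFr w).2 ≤ (loFr w).1 * (hiFr (pre tper 12)).2) :
    cf0 tper ≤ cf0 h := by
  subst hw
  have h2 := loFr_le_cf0 hpos h0 h1
  have tp := fun n => pos_of_mem tper_mem n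
  have h3 := cf0_le_hiFr tp (n := 12) (le_two_of_mem tper_mem _) (le_two_of_mem tper_mem _)
  refine h3.trans (le_trans ?_ h2)
  have p1 : (0 : ℝ) < (loFr (pre h m)).2 := by exact_mod_cast loFr_pos (pos_of_mem_pre hpos m)
  have p2 : (0 : ℝ) < (hiFr (pre tper 12)).2 := by exact_mod_cast hiFr_pos (pos_of_mem_pre tp 12)
  rw [div_le_div_iff₀ p2 p1]
  exact_mod_cast hc

lemma cf0_tper_sub_le (n : ℕ) {h : ℕ → ℕ} (hpos : ∀ n, 0 < h n) (h0 : h 0 = 1)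
    (hd : ∀ k < 6 * n + 12, h k = 1 ∨ h k = 2)
    (h1 : ∀ k < 6 * n + 6, pre (fun j => h (k + j)) 3 ≠ [1, 2, 1])
    (h2 : ∀ k < 6 * n + 6, pre (fun j => h (k + j)) 7 ≠ [1, 2, 2, 2, 1, 2, 2]) :
    cf0 tper - (1 / 4) ^ (3 * n) ≤ cf0 (fun k => h (k + 1)) := by
  have gpos : ∀ k, 0 < h (k + 1) := fun k => hpos _
  induction n generalizing h with
  | zero =>
    have a1 := cf0_le_one fun n => pos_of_mem tper_mem n
    have a2 := cf0_pos gpos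
    norm_num
    linarith
  | succ n ih =>
    have e0 : (0 : ℝ) ≤ (1 / 4) ^ (3 * (n + 1)) := by positivity
    have d1 := hd 1 (by omega)
    have d2 := hd 2 (by omega)
    have d3 := hd 3 (by omega)
    have d4 := hd 4 (by omega)
    have d5 := hd 5 (by omega)
    have d6 := hd 6 (by omega)
    have d7 := hd 7 (by omega)
    have d8 := hd 8 (by omega)
    have a1 := h1 0 (by omega)
    have a2 := h2 0 (by omega)
    have a3 := h1 4 (by omega)
    simp only [pre, List.range_succ, List.range_zero, List.nil_append,
      List.map_cons, List.map_nil, List.cons_append, zero_add, Nat.reduceAdd, add_zero, ne_eq,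
      List.cons.injEq, and_true, h0, true_and, not_and] at a1 a2 a3
    have fin : ∀ {w : List ℕ} {m : ℕ}, pre (fun k => h (k + 1)) m = w → m ≤ 6 →
        (hiFr (pre tper 12)).1 * (loFr w).2 ≤ (loFr w).1 * (hiFr (pre tper 12)).2 →
        cf0 tper - (1 / 4) ^ (3 * (n + 1)) ≤ cf0 (fun k => h (k + 1)) := by
      intro w m hw hm hc
      have q1 := hd (m + 1) (by omega)
      have q2 := hd (m + 2) (by omega)
      have := cf0_tper_le_of_pre gpos hw (by omega) (by change h (m + 2) ≤ 2; omega) hc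
      linarith
    rcases d1 with d1 | d1
    · exact fin (m := 1) (w := [1]) (by simp [pre, d1]) (by omega) (by decide +kernel)
    have d2 : h 2 = 2 := by omega
    rcases d3 with d3 | d3
    · exact fin (m := 3) (w := [2, 2, 1]) (by simp [pre, List.range_succ, d1, d2, d3]) (by omega)
        (by decide +kernel)
    rcases d4 with d4 | d4
    swap
    · exact fin (m := 4) (w := [2, 2, 2, 2]) (by simp [pre, List.range_succ, d1, d2, d3, d4])
        (by omega) (by decide +kernel)
    have d5 : h 5 = 1 := by
      rcases d5 with d5 | d5
      · exact d5
      · have := a2 d1 d2 d3 d4 d5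
        have := a3 d4 d5
        omega
    rcases d6 with d6 | d6
    swap
    · exact fin (m := 6) (w := [2, 2, 2, 1, 1, 2])
        (by simp [pre, List.range_succ, d1, d2, d3, d4, d5, d6]) (by omega) (by decide +kernel)
    have hi := ih (h := fun k => h (6 + k)) (fun _ => hpos _) d6 (fun k hk => hd _ (by omega))
      (fun k hk => by simpa only [Nat.add_assoc] using h1 (6 + k) (by omega))
      (fun k hk => by simpa only [Nat.add_assoc] using h2 (6 + k) (by omega)) fun _ => hpos _
    have e := cf0_eq_mob gpos 6
    have e6 : pre (fun k => h (k + 1)) 6 = [2, 2, 2, 1, 1, 1] := by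
      simp [pre, List.range_succ, d1, d2, d3, d4, d5, d6]
    rw [e6] at e
    rw [e, cf0_tper]
    have := mob_sub_le (w := [2, 2, 2, 1, 1, 1]) (by simp) (by simp)
      (cf0_pos fun n => pos_of_mem tper_mem n).le (cf0_pos fun _ => hpos _).le (by positivity) hi
    refine le_trans (le_of_eq ?_) this
    rw [mul_add, pow_add]
    simp only [List.length_cons, List.length_nil]
    norm_num
    ring

lemma cf0_tper_sub_le_rseq {A : ℤ → ℕ} (hA : ∀ n, 0 < A n) {p : ℤ} (hp : A p = 1) {n K : ℕ}
    (hD : Dig A (p - K) (p + K)) (hF : Free FW A (p - K) (p + K)) (hK : 6 * n + 20 ≤ K) :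
    cf0 tper - (1 / 4) ^ (3 * n) ≤ cf0 (rseq A p) := by
  have e : rseq A p = fun k => (fun m : ℕ => A (p + m)) (k + 1) := by
    funext k; simp only [rseq]; congr 1; push_cast; ring
  have occ : ∀ w ∈ FW, w.length ≤ 7 → ∀ k < 6 * n + 6,
      pre (fun j => (fun m : ℕ => A (p + m)) (k + j)) w.length ≠ w := by
    intro w hw h7 k hk hpre
    refine hF w hw (p + k) (by omega) (by omega) ?_
    have := occursAtZ_of_pre_eq (A := A) (a := p + k) (n := w.length) (u := []) (w := w) (v := [])
    simp only [List.append_nil, List.nil_append, List.length_nil, Nat.cast_zero, add_zero] at this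
    refine this ?_
    simpa only [Nat.cast_add, add_assoc] using hpre
  have o1 := occ [1, 2, 1] (by decide +kernel) (by simp)
  have o2 := occ [1, 2, 2, 2, 1, 2, 2] (by decide +kernel) (by simp)
  rw [e]
  exact cf0_tper_sub_le n (h := fun m : ℕ => A (p + m)) (fun _ => hA _) (by simpa using hp)
    (fun k hk => hD _ (by omega) (by omega)) o1 o2

/-- The left half that a special position must have. -/
def repL : List ℕ := [2, 2, 2, 1, 1, 2, 2, 1, 2, 2, 2, 2, 1, 1, 2]

lemma pre_of_sp {C : ℝ} (hC : C < CInf) : ∃ K : ℕ, ∀ A : ℤ → ℕ, (∀ n, 0 < A n) → ∀ i : ℤ,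
    Dig A (i - K) (i + K) → Free FW A (i - K) (i + K) → lam A i ≤ C → Sp A i →
    pre (lseq A i) 15 = repL := by
  obtain ⟨n, hn⟩ := exists_pow_lt_of_lt_one (half_pos (sub_pos.2 hC))
    (show (1 / 4 : ℝ) < 1 by norm_num)
  refine ⟨6 * n + 80, fun A hA i hD hF hl ⟨hi, hsl, hsr⟩ => ?_⟩
  have hg : grow FW (fun l r => repL.isPrefixOf l || (above 31181201783287460160928 l r ||
      (extL.isPrefixOf l && extR.isPrefixOf r))) 60 (pre (lseq A i) 6) (pre (rseq A i) 8)
        = true := by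
    rw [hsl, hsr]; decide +kernel
  obtain ⟨m, m', hm, hm', h⟩ := grow_sound hi (K := 6 * n + 80) hD hF hg (by omega) (by omega)
  rw [Bool.or_eq_true, Bool.or_eq_true, Bool.and_eq_true] at h
  rcases h with h | h | ⟨h, h'⟩
  · exact pre_of_isPrefixOf h
  · have h1 := lt_lam_of_above hA (K := 6 * n + 80) hi hD (by omega) (by omega) h
    have h2 := CInf_bounds.2
    push_cast at h1
    linarith
  · exfalso
    have hL : pre (lseq A i) 16 = extL := pre_of_isPrefixOf h
    have hR : pre (rseq A i) 32 = extR := pre_of_isPrefixOf h'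
    have tp := cf0_pos fun n => pos_of_mem tper_mem n
    have h4 : (1 / 4 : ℝ) ^ (3 * n) ≤ (1 / 4) ^ n :=
      pow_le_pow_of_le_one (by norm_num) (by norm_num) (by omega)
    have h4' : (0 : ℝ) ≤ (1 / 4) ^ (3 * n) := by positivity
    have c1 : cf0 tper - (1 / 4) ^ (3 * n) ≤ cf0 (rseq A (i + 32)) := by
      refine cf0_tper_sub_le_rseq hA ?_ (K := 6 * n + 20) (hD.mono ?_ ?_) (hF.mono ?_ ?_) le_rfl
      · have : rseq A i 31 = 1 := getD_of_pre_eq hR (by norm_num) 0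
        rw [← this]; simp only [rseq]; congr 1; push_cast; ring
      all_goals push_cast; linarith
    have c2 : cf0 tper - (1 / 4) ^ (3 * n) ≤ cf0 (lseq A (i - 16)) := by
      have := cf0_tper_sub_le_rseq (rev_pos hA) (p := -(i - 16)) (n := n) (K := 6 * n + 20) ?_
        (hD.reversed.mono ?_ ?_) ((hF.reversed FW_reverse).mono ?_ ?_) le_rfl
      · rwa [rseq_rev, neg_neg] at this
      · have : lseq A i 15 = 1 := getD_of_pre_eq hL (by norm_num) 0
        rw [← this]; simp only [rev, lseq]; congr 1; push_cast; ring
      all_goals push_cast; linarith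
    have e1 := cf0_eq_mob (rseq_pos hA i) 32
    have e2 := cf0_eq_mob (lseq_pos hA i) 16
    have f1 : (fun k => rseq A i (32 + k)) = rseq A (i + 32) := by
      funext k; simp only [rseq]; congr 1; push_cast; ring
    have f2 : (fun k => lseq A i (16 + k)) = lseq A (i - 16) := by
      funext k; simp only [lseq]; congr 1; push_cast; ring
    rw [hR, f1] at e1
    rw [hL, f2] at e2
    have b1 := mob_sub_le (w := extR) (by decide) (by decide) tp.le
      (cf0_pos (rseq_pos hA (i + 32))).le h4' c1
    have b2 := mob_sub_le (w := extL) (by decide) (by decide) tp.le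
      (cf0_pos (lseq_pos hA (i - 16))).le h4' c2
    have g1 : (1 / 4 : ℝ) ^ (extR.length / 2) * (1 / 4) ^ (3 * n) ≤ (1 / 4) ^ (3 * n) :=
      mul_le_of_le_one_left h4' (pow_le_one₀ (by norm_num) (by norm_num))
    have g2 : (1 / 4 : ℝ) ^ (extL.length / 2) * (1 / 4) ^ (3 * n) ≤ (1 / 4) ^ (3 * n) :=
      mul_le_of_le_one_left h4' (pow_le_one₀ (by norm_num) (by norm_num))
    have hcat := CInf_eq
    rw [cf0_catSeq (by decide) (fun n => pos_of_mem tper_mem n),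
      cf0_catSeq (by decide) (fun n => pos_of_mem tper_mem n)] at hcat
    have hlam := lam_eq hA i
    rw [hi, e1, e2] at hlam
    push_cast at hlam
    linarith

/-- Left of a special position there is another one, nine places away. -/
lemma sp_sub_nine {A : ℤ → ℕ} {i : ℤ} (h : pre (lseq A i) 15 = repL) (hs : Sp A i) :
    Sp A (i - 9) ∧ ∀ k < 9, lseq A i k = lper k := by
  have hl : ∀ k < 15, lseq A i k = repL.getD k 0 := fun k hk => getD_of_pre_eq h hk 0
  have hA : ∀ k : ℕ, k < 15 → A (i - 1 - k) = repL.getD k 0 := hl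
  have h0 := hs.1
  refine ⟨⟨?_, ?_, ?_⟩, fun k hk => ?_⟩
  · have := hA 8 (by norm_num)
    rwa [show i - 1 - ((8 : ℕ) : ℤ) = i - 9 by push_cast; ring] at this
  · have : ∀ k < 6, lseq A (i - 9) k = lseq A i (9 + k) := fun k _ => by
      simp only [lseq]; congr 1; push_cast; ring
    rw [pre_congr this, pre_congr (h := fun k => repL.getD (9 + k) 0) fun k hk => hl _ (by omega)]
    decide
  · have : ∀ k < 8, rseq A (i - 9) k = repL.getD (7 - k) 0 := fun k hk => by
      rw [← hA _ (by omega)]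
      simp only [rseq]; congr 1; omega
    rw [pre_congr this]
    decide
  · rw [hl k (by omega)]
    interval_cases k <;> rfl

/-! ### Consequences of having special positions -/

lemma cf0_pos_rseq {A : ℤ → ℕ} (hA : ∀ n, 0 < A n) (i : ℤ) : 0 < cf0 (rseq A i) :=
  cf0_pos (rseq_pos hA i)

lemma cf0_pos_lseq {A : ℤ → ℕ} (hA : ∀ n, 0 < A n) (i : ℤ) : 0 < cf0 (lseq A i) :=
  cf0_pos (lseq_pos hA i)

lemma CInf_lt : CInf < 13 / 4 := by
  have := CInf_bounds.2
  norm_num at this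
  linarith

lemma dig_of_lam {A : ℤ → ℕ} (hA : ∀ n, 0 < A n) {lo hi : ℤ}
    (hl : ∀ j, lo ≤ j → j ≤ hi → lam A j ≤ CInf) : Dig A lo (hi - 1) := by
  have h3 : ∀ j, lo ≤ j → j ≤ hi → A j ≤ 3 := by
    intro j h1 h2
    by_contra! h
    have h4 : (4 : ℝ) ≤ A j := by exact_mod_cast h
    have := lam_eq hA j
    have := hl j h1 h2
    have := cf0_pos_rseq hA j
    have := cf0_pos_lseq hA j
    have := CInf_lt
    linarith
  intro j h1 h2
  have h4 := h3 j h1 (by omega)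
  have h5 := hA j
  by_contra! h
  have h6 : A j = 3 := by omega
  have h7 : (1 : ℝ) / 4 ≤ cf0 (rseq A j) := by
    have p : ∀ n, 0 < rseq A j (n + 1) := fun n => rseq_pos hA j _
    have q : (rseq A j 0 : ℝ) ≤ 3 := by
      have := h3 (j + 1) (by omega) (by omega)
      have e : rseq A j 0 = A (j + 1) := by simp [rseq]
      rw [e]; exact_mod_cast this
    have := cf0_le_one p
    have := cf0_pos p
    rw [cf0_eq (rseq_pos hA j)]
    exact one_div_le_one_div_of_le (by positivity) (by linarith)
  have h8 := lam_eq hA j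
  rw [h6] at h8
  have := hl j h1 (by omega)
  have := cf0_pos_lseq hA j
  have := CInf_lt
  push_cast at h8
  linarith

lemma lseq_of_sp {C : ℝ} (hC : C < CInf) : ∃ K : ℕ, ∀ A : ℤ → ℕ, (∀ n, 0 < A n) →
    ∀ lo hi i : ℤ, Dig A lo hi → Free FW A lo hi → (∀ j, lo ≤ j → j ≤ hi → lam A j ≤ C) →
    Sp A i → i + K ≤ hi → ∀ k : ℕ, lo + K + k ≤ i → lseq A i k = lper k := by
  obtain ⟨K, hK⟩ := pre_of_sp hC
  refine ⟨K, fun A hA lo hi i hD hF hl hs hi' k hk => ?_⟩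
  have step : ∀ p : ℤ, p ≤ i → lo + K ≤ p → Sp A p →
      Sp A (p - 9) ∧ ∀ k < 9, lseq A p k = lper k := fun p h1 h2 h3 =>
    sp_sub_nine (hK A hA p (hD.mono (by omega) (by omega)) (hF.mono (by omega) (by omega))
      (hl p (by omega) (by omega)) h3) h3
  have sp : ∀ q : ℕ, lo + K + 9 * q ≤ i → Sp A (i - 9 * q) := by
    intro q
    induction q with
    | zero => intro; simpa using hs
    | succ q ih =>
      intro h
      push_cast at h
      have := (step (i - 9 * q) (by omega) (by omega) (ih (by omega))).1
      rwa [show i - 9 * ((q + 1 : ℕ) : ℤ) = i - 9 * q - 9 by push_cast; ring]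
  have h := (step (i - 9 * (k / 9 : ℕ)) (by omega) (by omega) (sp (k / 9) (by omega))).2 (k % 9)
    (Nat.mod_lt _ (by norm_num))
  rw [← Nat.mod_add_div k 9, lper_add, ← h]
  simp only [lseq]
  congr 1
  push_cast
  ring

lemma lper_sub (t k : ℕ) (hk : k + 2 ≤ 9 * t) : lper (9 * t - 2 - k) = rper k := by
  have h1 : 9 * t - 2 - k = (16 - k % 9) % 9 + 9 * ((9 * t - 2 - k) / 9) := by omega
  have h2 : k = k % 9 + 9 * (k / 9) := by omega
  rw [h1, lper_add]
  conv_rhs => rw [h2, rper_add]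
  have : k % 9 < 9 := Nat.mod_lt _ (by norm_num)
  generalize k % 9 = r at this
  interval_cases r <;> rfl

lemma lam_near_of_sp {A : ℤ → ℕ} (hA : ∀ n, 0 < A n) {i j : ℤ} {n : ℕ} (hn : 3 ≤ n)
    (hs : Sp A i) (hj : i + 2 * n + 1 ≤ j)
    (hl : ∀ k : ℕ, (k : ℤ) < j - i + 2 * n → lseq A j k = lper k) :
    |lam A i - cInf| ≤ 2 * (1 / 4) ^ n := by
  obtain ⟨d, rfl⟩ := Int.le.dest (show i ≤ j by omega)
  have hL : ∀ k < 2 * n, lseq A i k = lper (d + k) := fun k hk => by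
    rw [← hl (d + k) (by omega)]
    simp only [lseq]; congr 1; push_cast; ring
  have hd : d % 9 = 0 := by
    have h := hs.2.1
    rw [pre_congr fun k (hk : k < 6) => hL k (by omega)] at h
    have h1 : ∀ k, lper (d + k) = lper (d % 9 + k) := fun k => by
      rw [show d + k = d % 9 + k + 9 * (d / 9) by omega, lper_add]
    simp only [h1] at h
    have : d % 9 < 9 := Nat.mod_lt _ (by norm_num)
    generalize d % 9 = r at this h
    revert h
    interval_cases r <;> decide
  obtain ⟨t, rfl⟩ := Nat.dvd_of_mod_eq_zero hd
  have hR : ∀ k < 2 * n, rseq A i k = rper k := fun k hk => by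
    rw [← lper_sub t k (by omega), ← hl _ (by omega)]
    simp only [rseq, lseq]; congr 1; omega
  have e1 := abs_cf0_sub_le (lseq_pos hA i) (fun n => pos_of_mem lper_mem n) n fun k hk => by
    rw [hL k hk, add_comm, lper_add]
  have e2 := abs_cf0_sub_le (rseq_pos hA i) (fun n => pos_of_mem rper_mem n) n hR
  have e3 := lam_eq hA i
  rw [hs.1] at e3
  rw [e3, cInf_eq]
  rw [abs_le] at *
  push_cast
  constructor <;> linarith [e1.1, e1.2, e2.1, e2.2]

lemma lam_lt_of_two_sp {C ε : ℝ} (hC : C < CInf) (hε : 0 < ε) : ∃ R : ℕ, ∀ A : ℤ → ℕ,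
    (∀ n, 0 < A n) → ∀ lo hi i j : ℤ, (∀ j, lo ≤ j → j ≤ hi → lam A j ≤ C) → Sp A i → Sp A j →
    lo + R ≤ i → i + R ≤ j → j + R ≤ hi → lam A i < cInf + ε := by
  obtain ⟨K, hK⟩ := lseq_of_sp hC
  obtain ⟨n, hn⟩ := exists_pow_lt_of_lt_one (half_pos hε) (show (1 / 4 : ℝ) < 1 by norm_num)
  refine ⟨K + 2 * n + 200, fun A hA lo hi i j hl hi' hj h1 h2 h3 => ?_⟩
  push_cast at h1 h2 h3
  have hl' : ∀ j, lo ≤ j → j ≤ hi → lam A j ≤ CInf := fun j h1 h2 => (hl j h1 h2).trans hC.le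
  have hD := dig_of_lam hA hl'
  have hF := free_FW hA hD fun j h1 h2 => hl' j h1 (by omega)
  have h := lam_near_of_sp hA (n := n + 3) (by omega) hi' (j := j) (by push_cast; omega) fun k hk =>
    hK A hA (lo + 80) (hi - 1 - 80) j (hD.mono (by omega) (by omega)) hF
      (fun j h1 h2 => hl j (by omega) (by omega)) hj (by omega) k (by push_cast at hk; omega)
  have h5 : (1 / 4 : ℝ) ^ (n + 3) ≤ (1 / 4) ^ n :=
    pow_le_pow_of_le_one (by norm_num) (by norm_num) (by omega)
  have := (abs_le.1 h).2
  linarith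

/-- Positions with large value are special, in one of the two orientations. -/
lemma sp_of_lt_lam {A : ℤ → ℕ} (hA : ∀ n, 0 < A n) {i : ℤ}
    (hl : ∀ j, i - 200 ≤ j → j ≤ i + 200 → lam A j ≤ CInf) (h : cInf ≤ lam A i) :
    Sp A i ∨ Sp (rev A) (-i) := by
  have hD := dig_of_lam hA hl
  have hF := free_FW hA hD fun j h1 h2 => hl j h1 (by omega)
  refine (lam_lt_or_sp hA (hD.mono (by omega) (by omega))
    (hF.mono (by omega) (by omega))).resolve_left ?_
  have := cInf_bounds.1
  linarith

lemma lam_nonneg {A : ℤ → ℕ} (hA : ∀ n, 0 < A n) (i : ℤ) : 0 ≤ lam A i := by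
  rw [lam_eq hA]
  have := cf0_pos_rseq hA i
  have := cf0_pos_lseq hA i
  positivity

lemma not_mem_lagrangeSpectrum {x : ℝ} (h1 : cInf < x) (h2 : x < CInf) :
    x ∉ LagrangeSpectrum := by
  rintro ⟨A, hA, hb, rfl⟩
  unfold lagrangeVal at h1 h2
  set x := limsup (lam A) atTop
  set C := (x + CInf) / 2
  set c := (cInf + x) / 2
  have hC : C < CInf := by simp only [C]; linarith
  have hxC : x < C := by simp only [C]; linarith
  have hc : cInf < c := by simp only [c]; linarith
  have hcx : c < x := by simp only [c]; linarith
  obtain ⟨N, hN⟩ := eventually_atTop.1 (eventually_lt_of_limsup_lt hxC hb)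
  have hcob : IsCoboundedUnder (· ≤ ·) atTop (lam A) :=
    IsBoundedUnder.isCoboundedUnder_le ⟨0, eventually_map.2 (Eventually.of_forall (lam_nonneg hA))⟩
  have hfr := frequently_lt_of_lt_limsup hcob hcx
  have hsp : ∃ᶠ i in atTop, (Sp A i ∧ c < lam A i) ∨ (Sp (rev A) (-i) ∧ c < lam A i) := by
    refine (hfr.and_eventually (eventually_ge_atTop (N + 200))).mono fun i hi => ?_
    rcases sp_of_lt_lam hA (fun j hj _ => ((hN j (by omega)).trans hC).le)
      (hc.trans hi.1).le with h | h
    exacts [Or.inl ⟨h, hi.1⟩, Or.inr ⟨h, hi.1⟩]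
  obtain ⟨R, hR⟩ := lam_lt_of_two_sp hC (sub_pos.2 hc)
  rcases frequently_or_distrib.1 hsp with h | h
  · obtain ⟨i, hi, hsi, hli⟩ := frequently_atTop.1 h (N + R)
    obtain ⟨j, hj, hsj, -⟩ := frequently_atTop.1 h (i + R)
    have := hR A hA N (j + R) i j (fun j hj _ => (hN j hj).le) hsi hsj hi hj le_rfl
    linarith
  · obtain ⟨i, hi, hsi, -⟩ := frequently_atTop.1 h (N + R)
    obtain ⟨j, hj, hsj, hlj⟩ := frequently_atTop.1 h (i + R)
    have := hR (rev A) (rev_pos hA) (-(j + R)) (-N) (-j) (-i)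
      (fun j _ hj => by rw [lam_rev hA]; exact (hN _ (by omega)).le) hsj hsi
      (by omega) (by omega) (by omega)
    rw [lam_rev hA, neg_neg] at this
    linarith

/-! ### The upper bound for the dimension -/

lemma sp_of_occursAtZ {A : ℤ → ℕ} {s : ℤ} (h : occursAtZ spWord A s) : Sp A (s + 6) :=
  windows_of_occursAtZ (c := 6) h (by decide)

lemma sp_rev_of_occursAtZ {A : ℤ → ℕ} {s : ℤ} (h : occursAtZ spWord.reverse A s) :
    Sp (rev A) (-(s + 8)) := by
  rw [← rev_rev A] at h
  have h1 := occursAtZ_rev h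
  rw [List.reverse_reverse] at h1
  have h2 := sp_of_occursAtZ h1
  have e : (1 - s - (spWord.reverse.length : ℤ) + 6) = -(s + 8) := by
    rw [show spWord.reverse.length = 15 from rfl]; push_cast; ring
  rwa [e] at h2

lemma finite_of_gap {S : Set ℤ} {R : ℕ} (h : ∀ i ∈ S, ∀ j ∈ S, ¬ i + R ≤ j) : S.Finite := by
  rcases S.eq_empty_or_nonempty with rfl | ⟨a, ha⟩
  · exact finite_empty
  · refine (finite_Icc (a - R) (a + R)).subset fun b hb => ?_
    have h1 := h a ha b hb
    have h2 := h b hb a ha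
    exact ⟨by omega, by omega⟩

/-- A Markov value in `(cInf, CInf)` is attained at a special position. -/
lemma exists_sp_of_mem {x : ℝ} (hx : x ∈ MarkovSpectrum) (h1 : cInf < x) (h2 : x < CInf) :
    ∃ A : ℤ → ℕ, (∀ n, 0 < A n) ∧ (∀ j, lam A j ≤ x) ∧ ∃ i, Sp A i ∧ lam A i = x := by
  obtain ⟨A, hA, hb, rfl⟩ := hx
  set x := markovVal A with hxdef
  have hle : ∀ j, lam A j ≤ x := fun j => le_csSup hb ⟨j, rfl⟩
  set c := (cInf + x) / 2
  have hc : cInf < c := by simp only [c]; linarith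
  have hcx : c < x := by simp only [c]; linarith
  have hsp : ∀ i, c < lam A i → Sp A i ∨ Sp (rev A) (-i) := fun i hi =>
    sp_of_lt_lam hA (fun j _ _ => (hle j).trans h2.le) (hc.trans hi).le
  obtain ⟨R, hR⟩ := lam_lt_of_two_sp h2 (sub_pos.2 hc)
  have f1 : {i | Sp A i ∧ c < lam A i}.Finite := by
    refine finite_of_gap (R := R) fun i hi j hj hij => ?_
    have := hR A hA (i - R) (j + R) i j (fun j _ _ => hle j) hi.1 hj.1 (by omega) hij (by omega)
    linarith [hi.2]
  have f2 : {i | Sp (rev A) (-i) ∧ c < lam A i}.Finite := by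
    refine finite_of_gap (R := R) fun i hi j hj hij => ?_
    have := hR (rev A) (rev_pos hA) (-j - R) (-i + R) (-j) (-i)
      (fun j _ _ => by rw [lam_rev hA]; exact hle _) hj.1 hi.1 (by omega) (by omega) (by omega)
    rw [lam_rev hA, neg_neg] at this
    linarith [hj.2]
  have f : {i | c < lam A i}.Finite := (f1.union f2).subset fun i hi =>
    (hsp i hi).imp (fun h => ⟨h, hi⟩) fun h => ⟨h, hi⟩
  obtain ⟨-, ⟨k, rfl⟩, hk⟩ := exists_lt_of_lt_csSup (range_nonempty (lam A)) hcx
  obtain ⟨i, hi, hmax⟩ := exists_max_image _ (lam A) f ⟨k, hk⟩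
  have hix : lam A i = x := by
    refine le_antisymm (hle i) (csSup_le (range_nonempty _) ?_)
    rintro - ⟨j, rfl⟩
    rcases lt_or_ge c (lam A j) with h | h
    · exact hmax j h
    · exact h.trans (le_of_lt hi)
  rcases hsp i hi with h | h
  · exact ⟨A, hA, hle, i, h, hix⟩
  · exact ⟨rev A, rev_pos hA, fun j => by rw [lam_rev hA]; exact hle _, -i, h, by
      rw [lam_rev hA, neg_neg, hix]⟩

lemma lseq_eq_lper {A : ℤ → ℕ} (hA : ∀ n, 0 < A n) {x : ℝ} (hx : x < CInf)
    (hle : ∀ j, lam A j ≤ x) {i : ℤ} (hi : Sp A i) : lseq A i = lper := by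
  obtain ⟨K, hK⟩ := lseq_of_sp hx
  funext k
  have hD : ∀ lo hi, Dig A lo hi := fun lo hi =>
    (dig_of_lam hA (hi := hi + 1) fun j _ _ => (hle j).trans hx.le).mono le_rfl (by omega)
  have hF : Free FW A (i - K - k) (i + K) :=
    (free_FW hA (hD (i - K - k - 80) (i + K + 80)) fun j _ _ => (hle j).trans hx.le).mono
      (by omega) (by omega)
  exact hK A hA (i - K - k) (i + K) i (hD _ _) hF (fun j _ _ => hle j) hi le_rfl k (by omega)

lemma exists_mob_of_mem {x : ℝ} (hx : x ∈ MarkovSpectrum) (h1 : cInf < x) (h2 : x < CInf) :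
    ∃ w : {w : List ℕ // ∀ d ∈ w, 0 < d}, ∃ y ∈ Yset ∪ {cf0 lper},
      2 + mob w y + cf0 lper = x := by
  obtain ⟨A, hA, hle, i, hi, rfl⟩ := exists_sp_of_mem hx h1 h2
  have hD : ∀ lo hi, Dig A lo hi := fun lo hi =>
    (dig_of_lam hA (hi := hi + 1) fun j _ _ => (hle j).trans h2.le).mono le_rfl (by omega)
  have hF : ∀ lo hi, Free FW A lo hi := fun lo hi =>
    (free_FW hA (hD (lo - 80) (hi + 80)) fun j _ _ => (hle j).trans h2.le).mono
      (by omega) (by omega)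
  have e : ∀ m : ℕ, 2 + mob (pre (rseq A i) m) (cf0 (rseq A (i + m))) + cf0 lper = lam A i := by
    intro m
    have f : (fun k => rseq A i (m + k)) = rseq A (i + m) := by
      funext k; simp only [rseq]; congr 1; push_cast; ring
    rw [lam_eq hA, hi.1, ← lseq_eq_lper hA h2 hle hi, cf0_eq_mob (rseq_pos hA i) m, f]
    push_cast
    ring
  suffices h : ∃ m : ℕ, cf0 (rseq A (i + m)) ∈ Yset ∪ {cf0 lper} by
    obtain ⟨m, hm⟩ := h
    exact ⟨⟨pre (rseq A i) m, pos_of_mem_pre (rseq_pos hA i) m⟩, _, hm, e m⟩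
  by_cases ha : ∃ m : ℕ, Sp (rev A) (-(i + m))
  · obtain ⟨m, hm⟩ := ha
    have := lseq_eq_lper (rev_pos hA) h2 (fun j => by rw [lam_rev hA]; exact hle _) hm
    rw [lseq_rev, neg_neg] at this
    exact ⟨m, Or.inr (by rw [this]; rfl)⟩
  · obtain ⟨R, hR⟩ := lam_lt_of_two_sp h2 (sub_pos.2 h1)
    refine ⟨R, Or.inl ⟨rseq A (i + R), fun n => hD _ _ _ le_rfl le_rfl, ?_, rfl⟩⟩
    rintro w hw ⟨k, hk⟩
    have hk' : occursAtZ w A (i + R + 1 + k) := fun l hl => by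
      rw [← hk l hl]; simp only [rseq]; congr 1; push_cast; ring
    rcases List.mem_append.1 hw with hw | hw
    · exact hF (i + R + 1 + k) (i + R + 1 + k + w.length) w hw _ le_rfl (by omega) hk'
    · simp only [List.mem_cons, List.not_mem_nil, or_false] at hw
      rcases hw with rfl | rfl
      · have := hR A hA (i - R) (i + R + 1 + k + 6 + R) i (i + R + 1 + k + 6)
          (fun j _ _ => hle j) hi (sp_of_occursAtZ hk') (by omega) (by omega) (by omega)
        linarith
      · refine ha ⟨R + 1 + k + 8, ?_⟩
        have := sp_rev_of_occursAtZ hk'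
        push_cast
        rwa [show i + ((R : ℤ) + 1 + k + 8) = i + R + 1 + k + 8 by ring]

lemma Yset_subset : Yset ⊆ Icc 0 1 := by
  rintro - ⟨g, hg, -, rfl⟩
  exact ⟨(cf0_pos (pos_of_mem hg)).le, cf0_le_one (pos_of_mem hg)⟩

lemma lipschitzOnWith_mob {w : List ℕ} (hw : ∀ d ∈ w, 0 < d) (a b : ℝ) :
    LipschitzOnWith 1 (fun y => a + mob w y + b) (Icc 0 1) := by
  refine LipschitzOnWith.of_dist_le_mul fun s hs t ht => ?_
  rw [Real.dist_eq, Real.dist_eq, NNReal.coe_one, one_mul]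
  convert abs_mob_sub_le hw hs.1 ht.1 using 2
  ring

lemma dimH_inter_le_dimH_Yset :
    dimH ((MarkovSpectrum \ LagrangeSpectrum) ∩ Ioo cInf CInf) ≤ dimH Yset := by
  have hp : cf0 lper ∈ Icc (0 : ℝ) 1 :=
    ⟨(cf0_pos fun n => pos_of_mem lper_mem n).le, cf0_le_one fun n => pos_of_mem lper_mem n⟩
  have hsub : (MarkovSpectrum \ LagrangeSpectrum) ∩ Ioo cInf CInf ⊆
      ⋃ w : {w : List ℕ // ∀ d ∈ w, 0 < d},
        (fun y => 2 + mob w y + cf0 lper) '' (Yset ∪ {cf0 lper}) := by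
    rintro x ⟨⟨hx, -⟩, h1, h2⟩
    obtain ⟨w, y, hy, e⟩ := exists_mob_of_mem hx h1 h2
    exact mem_iUnion.2 ⟨w, y, hy, e⟩
  refine (dimH_mono hsub).trans ?_
  rw [dimH_iUnion]
  refine iSup_le fun w => ?_
  refine (((lipschitzOnWith_mob w.2 2 (cf0 lper)).mono
    (union_subset Yset_subset (singleton_subset_iff.2 hp))).dimH_image_le).trans ?_
  rw [dimH_union, dimH_singleton]
  simp

/-! ### The lower bound for the dimension -/

lemma exists_le_mul_abs_mob_sub {w : List ℕ} (hw : ∀ d ∈ w, 0 < d) :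
    ∃ K : NNReal, ∀ s ∈ Icc (0 : ℝ) 1, ∀ t ∈ Icc (0 : ℝ) 1,
      |s - t| ≤ K * |mob w s - mob w t| := by
  induction w with
  | nil => exact ⟨1, fun s _ t _ => by simp⟩
  | cons d w ih =>
    have hw' : ∀ d ∈ w, 0 < d := fun e he => hw e (List.mem_cons_of_mem _ he)
    have hd : (0 : ℝ) < d := by exact_mod_cast hw d (by simp)
    obtain ⟨K, hK⟩ := ih hw'
    refine ⟨K * ((d : NNReal) + 1) ^ 2, fun s hs t ht => (hK s hs t ht).trans ?_⟩
    have a0 := mob_nonneg (w := w) hs.1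
    have b0 := mob_nonneg (w := w) ht.1
    have a1 := mob_le_one hw' hs.1 hs.2
    have b1 := mob_le_one hw' ht.1 ht.2
    rw [mob_cons, mob_cons]
    generalize mob w s = a at *
    generalize mob w t = b at *
    have e : a - b = -((d + a) * (d + b) * (1 / (d + a) - 1 / (d + b))) := by
      field_simp
      ring
    rw [e, abs_neg, abs_mul, abs_of_nonneg (by positivity : 0 ≤ ((d : ℝ) + a) * (d + b))]
    push_cast
    rw [mul_assoc (K : ℝ)]
    gcongr
    nlinarith

lemma dimH_le_dimH_image_mob {w : List ℕ} (hw : ∀ d ∈ w, 0 < d) (a b : ℝ) {S : Set ℝ}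
    (hS : S ⊆ Icc 0 1) : dimH S ≤ dimH ((fun y => a + mob w y + b) '' S) := by
  obtain ⟨K, hK⟩ := exists_le_mul_abs_mob_sub hw
  have h : AntilipschitzWith K (S.domRestrict fun y => a + mob w y + b) :=
    AntilipschitzWith.of_le_mul_dist fun s t => by
      rw [Subtype.dist_eq, Real.dist_eq, Real.dist_eq]
      convert hK s (hS s.2) t (hS t.2) using 3
      simp only [domRestrict_apply]
      ring
  have h1 := h.le_dimH_image univ
  rw [image_univ, range_domRestrict] at h1
  have h2 := isometry_subtype_coe.dimH_image (univ : Set S)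
  rw [image_univ, Subtype.range_coe] at h2
  rwa [h2]

/-- The right half of the sequences realising the lower bound starts with this word. -/
def rWord : List ℕ := [1, 2, 2, 1, 1, 2, 2, 2, 2, 1, 2, 2, 1, 1, 2, 2, 1, 1]

/-- Words that can follow `rWord`. -/
def qWords : List (List ℕ) :=
  [[1, 1, 1], [1, 1, 2, 2, 2], [2, 2, 2, 2, 2], [2, 2, 1, 1, 2, 2, 1], [2, 2, 1, 2, 2, 1, 2]]

/-- The one-sided analogue of `grow`. -/
def growRight (F : List (List ℕ)) : ℕ → List ℕ → Bool
  | 0, _ => false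
  | f + 1, l => containsWord F l || (growRight F f (l ++ [1]) && growRight F f (l ++ [2]))

lemma growRight_sound {F : List (List ℕ)} {g : ℕ → ℕ} (hg : ∀ n, g n = 1 ∨ g n = 2) {f m : ℕ}
    (h : growRight F f (pre g m) = true) : ∃ m', containsWord F (pre g m') = true := by
  induction f generalizing m with
  | zero => simp [growRight] at h
  | succ f ih =>
    rw [growRight, Bool.or_eq_true, Bool.and_eq_true] at h
    rcases h with h | ⟨h1, h2⟩
    · exact ⟨m, h⟩
    · refine ih (m := m + 1) ?_
      rw [pre_succ]
      rcases hg m with h | h <;> rw [h] <;> assumption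

lemma pre_mid {g : ℕ → ℕ} {n : ℕ} {u w v : List ℕ} (h : pre g n = u ++ (w ++ v)) :
    pre (fun k => g (u.length + k)) w.length = w := by
  have hl := congrArg List.length h
  simp only [length_pre, List.length_append] at hl
  obtain rfl : n = u.length + (w.length + v.length) := by omega
  rw [pre_add, pre_add] at h
  have h1 := (List.append_inj h (by simp)).2
  exact (List.append_inj h1 (by simp)).1

lemma occursAtN_of_pre {g : ℕ → ℕ} {w : List ℕ} {k : ℕ}
    (h : pre (fun j => g (k + j)) w.length = w) : occursAtN w g k :=
  fun _ hi => getD_of_pre_eq h hi 0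

lemma exists_qWord {g : ℕ → ℕ} (hg : ∀ n, g n = 1 ∨ g n = 2) (hP : avoidsP g) :
    ∃ m : ℕ, ∃ q ∈ qWords, pre (fun k => g (m + k)) q.length = q := by
  have h : growRight (Pwords ++ qWords) 30 (pre g 0) = true := by
    rw [pre_zero]; decide +kernel
  obtain ⟨m, hm⟩ := growRight_sound hg h
  obtain ⟨w, hw, u, v, e⟩ := exists_of_containsWord hm
  rcases List.mem_append.1 hw with hw | hw
  · exact absurd ⟨_, occursAtN_of_pre (pre_mid e)⟩ (hP w hw)
  · exact ⟨_, w, hw, pre_mid e⟩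

/-- The part of `Yset` of continued fractions that start with one of the words `qWords`. -/
def Ystart : Set ℝ :=
  {x | ∃ g : ℕ → ℕ, (∀ n, g n = 1 ∨ g n = 2) ∧ avoidsP g ∧ (∃ q ∈ qWords, pre g q.length = q) ∧
    x = cf0 g}

lemma Ystart_subset : Ystart ⊆ Icc 0 1 := by
  rintro - ⟨g, hg, hP, -, rfl⟩
  exact Yset_subset ⟨g, hg, hP, rfl⟩

lemma dimH_Yset_le : dimH Yset ≤ dimH Ystart := by
  have hsub : Yset ⊆ ⋃ w : {w : List ℕ // ∀ d ∈ w, 0 < d},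
      (fun y => 0 + mob w y + 0) '' Ystart := by
    rintro - ⟨g, hg, hP, rfl⟩
    obtain ⟨m, hm⟩ := exists_qWord hg hP
    refine mem_iUnion.2 ⟨⟨pre g m, pos_of_mem_pre (pos_of_mem hg) m⟩, cf0 fun k => g (m + k),
      ⟨_, fun n => hg _, fun w hw ⟨k, hk⟩ => hP w hw ⟨m + k, fun i hi => ?_⟩, hm, rfl⟩, ?_⟩
    · simpa using (cf0_eq_mob (pos_of_mem hg) m).symm
    · rw [add_assoc]; exact hk i hi
  refine (dimH_mono hsub).trans ?_
  rw [dimH_iUnion]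
  exact iSup_le fun w => ((lipschitzOnWith_mob w.2 0 0).mono Ystart_subset).dimH_image_le

/-- The bi-infinite sequence with a special position at `0`, periodic to the left, and continuing
with `rWord` and `g` to the right. -/
def glue (g : ℕ → ℕ) : ℤ → ℕ
  | Int.ofNat n => catSeq (2 :: rWord) g n
  | Int.negSucc k => lper k

lemma lseq_glue (g : ℕ → ℕ) : lseq (glue g) 0 = lper := by
  funext k
  have : (0 : ℤ) - 1 - k = Int.negSucc k := by rw [Int.negSucc_eq]; ring
  rw [lseq, this, glue]

lemma glue_natCast (g : ℕ → ℕ) (n : ℕ) : glue g n = catSeq (2 :: rWord) g n := rfl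

lemma glue_zero (g : ℕ → ℕ) : glue g 0 = 2 := rfl

lemma glue_add (g : ℕ → ℕ) (n : ℕ) : glue g (19 + n) = g n := by
  rw [show (19 : ℤ) + n = ((19 + n : ℕ) : ℤ) by push_cast; ring, glue_natCast]
  simp [catSeq, rWord]

lemma rseq_glue (g : ℕ → ℕ) : rseq (glue g) 0 = catSeq rWord g := by
  funext k
  rw [rseq, show (0 : ℤ) + 1 + k = ((k + 1 : ℕ) : ℤ) by push_cast; ring, glue_natCast]
  simp [catSeq]

lemma catSeq_eq_one_or_two {w : List ℕ} (hw : ∀ d ∈ w, d = 1 ∨ d = 2) {g : ℕ → ℕ}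
    (hg : ∀ n, g n = 1 ∨ g n = 2) (n : ℕ) : catSeq w g n = 1 ∨ catSeq w g n = 2 := by
  unfold catSeq
  split_ifs with h
  · rw [List.getD_eq_getElem _ _ h]
    exact hw _ (List.getElem_mem h)
  · exact hg _

lemma glue_mem {g : ℕ → ℕ} (hg : ∀ n, g n = 1 ∨ g n = 2) (n : ℤ) : glue g n = 1 ∨ glue g n = 2 := by
  cases n with
  | ofNat n => exact catSeq_eq_one_or_two (by decide) hg n
  | negSucc k => exact lper_mem k

lemma glue_pos {g : ℕ → ℕ} (hg : ∀ n, g n = 1 ∨ g n = 2) (n : ℤ) : 0 < glue g n := by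
  rcases glue_mem hg n with h | h <;> omega

lemma glue_add_nine (g : ℕ → ℕ) {n : ℤ} (hn : n ≤ 7) : glue g (n + 9) = glue g n := by
  rcases lt_or_ge n (-9) with h | h
  · obtain ⟨k, rfl⟩ : ∃ k : ℕ, n = Int.negSucc (k + 9) := ⟨(-10 - n).toNat, by omega⟩
    rw [show Int.negSucc (k + 9) + 9 = Int.negSucc k by omega]
    exact (lper_add k 1).symm
  · interval_cases n <;> rfl

lemma glue_sub (g : ℕ → ℕ) (k : ℕ) {n : ℤ} (hn : n ≤ 16) : glue g (n - 9 * k) = glue g n := by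
  induction k with
  | zero => simp
  | succ k ih =>
    rw [← ih, ← glue_add_nine g (n := n - 9 * (k + 1 : ℕ)) (by push_cast; omega)]
    congr 1; push_cast; ring

lemma pre_catSeq (w : List ℕ) (g : ℕ → ℕ) (n : ℕ) :
    pre (catSeq w g) (w.length + n) = w ++ pre g n := by
  rw [pre_add]
  congr 1
  · refine List.ext_getElem (by simp) fun i h1 h2 => ?_
    rw [getElem_pre, catSeq, if_pos h2, List.getD_eq_getElem _ _ h2]
  · exact pre_congr fun k _ => by simp [catSeq]

/-- The digits of `glue g` from position `-81` on, when `g` starts with `q`. -/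
def glueWindow (q : List ℕ) : List ℕ := (pre lper 81).reverse ++ 2 :: (rWord ++ q)

lemma pre_glue {g : ℕ → ℕ} {q : List ℕ} (hq : pre g q.length = q) :
    pre (fun k => glue g (-81 + k)) (100 + q.length) = glueWindow q := by
  have h := window_eq (glue g) 0 81 (rWord.length + q.length)
  rw [lseq_glue, rseq_glue, pre_catSeq, hq, glue_zero] at h
  rw [glueWindow, h]
  norm_num [rWord]
  congr 1
  omega

/-- Two words agree as long as both are defined. -/
def compat (w l : List ℕ) : Bool := (w.zip l).all fun p => p.1 == p.2

lemma compat_of_occursAtZ {A : ℤ → ℕ} {a : ℤ} {n N : ℕ} {w : List ℕ}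
    (h : occursAtZ w A (a + n)) : compat w ((pre (fun k => A (a + k)) N).drop n) = true := by
  rw [compat, List.all_eq_true]
  intro p hp
  obtain ⟨i, hi, rfl⟩ := List.mem_iff_getElem.1 hp
  simp only [List.length_zip, List.length_drop, length_pre] at hi
  simp only [List.getElem_zip, List.getElem_drop, getElem_pre, beq_iff_eq]
  have := h i (by omega)
  rw [List.getD_eq_getElem _ _ (by omega)] at this
  rw [← this]
  congr 1; push_cast; ring

lemma exists_start {g : ℕ → ℕ} (hP : avoidsP g) {w : List ℕ} (hw : w ∈ Pwords) {s : ℤ}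
    (h : occursAtZ w (glue g) s) :
    ∃ n : ℕ, n < 100 ∧ occursAtZ w (glue g) (-81 + n) ∧ s ≤ -81 + n ∧ 9 ∣ (-81 + n : ℤ) - s := by
  have hlen : w.length ≤ 31 := (by decide +kernel : ∀ w ∈ Pwords, w.length ≤ 31) w hw
  rcases lt_or_ge 18 s with hs | hs
  · refine absurd ⟨(s - 19).toNat, fun i hi => ?_⟩ (hP w hw)
    rw [← h i hi, ← glue_add g]
    congr 1; push_cast; omega
  · rcases lt_or_ge s (-72) with hs' | hs'
    · refine ⟨(81 + s + 9 * ((-64 - s) / 9)).toNat, by omega, fun i hi => ?_, by omega, by omega⟩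
      rw [← h i hi, ← glue_sub g ((-64 - s) / 9).toNat (by omega)]
      congr 1; omega
    · refine ⟨(81 + s).toNat, by omega, ?_, by omega, by omega⟩
      rwa [show -81 + ((81 + s).toNat : ℤ) = s by omega]

lemma not_compat_FW : ∀ q ∈ qWords, ∀ n < 100, ∀ w ∈ spWord.reverse :: FW,
    compat w ((glueWindow q).drop n) = false := by decide +kernel

lemma not_compat_spWord : ∀ q ∈ qWords, ∀ n < 100, n % 9 ≠ 3 ∨ 75 < n →
    compat spWord ((glueWindow q).drop n) = false := by decide +kernel

section

variable {g : ℕ → ℕ} {q : List ℕ}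

lemma not_occursAtZ_glue (hP : avoidsP g) (hq : q ∈ qWords) (hpre : pre g q.length = q)
    {w : List ℕ} (hw : w ∈ spWord.reverse :: FW) (s : ℤ) : ¬ occursAtZ w (glue g) s := by
  intro h
  have hw' : w ∈ Pwords := (by decide +kernel : ∀ w ∈ spWord.reverse :: FW, w ∈ Pwords) w hw
  obtain ⟨n, hn, ho, -⟩ := exists_start hP hw' h
  have := compat_of_occursAtZ (N := 100 + q.length) ho
  rw [pre_glue hpre, not_compat_FW q hq n hn w hw] at this
  exact absurd this (by simp)

lemma occursAtZ_of_sp {A : ℤ → ℕ} {i : ℤ} (h : Sp A i) : occursAtZ spWord A (i - 6) := by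
  have h1 := window_eq A i 6 8
  rw [h.1, h.2.1, h.2.2] at h1
  have := occursAtZ_of_pre_eq (u := []) (w := spWord) (v := []) h1.symm
  simpa using this

lemma not_sp_rev_glue (hP : avoidsP g) (hq : q ∈ qWords) (hpre : pre g q.length = q) (i : ℤ) :
    ¬ Sp (rev (glue g)) i := fun h =>
  not_occursAtZ_glue hP hq hpre (w := spWord.reverse) (by simp) _
    (occursAtZ_rev (occursAtZ_of_sp h))

lemma exists_of_sp_glue (hP : avoidsP g) (hq : q ∈ qWords) (hpre : pre g q.length = q) {i : ℤ}
    (h : Sp (glue g) i) : ∃ k : ℕ, i = -(9 * k : ℤ) := by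
  obtain ⟨n, hn, ho, hi, hd⟩ := exists_start hP (by decide) (occursAtZ_of_sp h)
  have hc := compat_of_occursAtZ (N := 100 + q.length) ho
  rw [pre_glue hpre] at hc
  have hn' : n % 9 = 3 ∧ n ≤ 75 := by
    by_contra hne
    rw [not_compat_spWord q hq n hn (by omega)] at hc
    exact absurd hc (by simp)
  exact ⟨(-i / 9).toNat, by omega⟩

lemma lt_lam_glue (hg : ∀ n, g n = 1 ∨ g n = 2) :
    ((31181201781585 * 10 ^ 9 : ℕ) : ℝ) / 10 ^ 22 < lam (glue g) 0 ∧
      lam (glue g) 0 < ((31181201781645 * 10 ^ 9 : ℕ) : ℝ) / 10 ^ 22 := by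
  have hp : pre (rseq (glue g) 0) 18 = rWord := by
    rw [rseq_glue]; simpa [pre_zero, rWord] using pre_catSeq rWord g 0
  have hD : ∀ lo hi, Dig (glue g) lo hi := fun lo hi n _ _ => glue_mem hg n
  have hA := glue_pos hg
  constructor
  · refine lt_lam_of_above (m := 45) (n := 18) (K := 60) hA (glue_zero g) (hD _ _) (by simp)
      (by simp) ?_
    rw [lseq_glue, hp]; decide +kernel
  · refine lam_lt_of_below (m := 45) (n := 18) (K := 60) hA (glue_zero g) (hD _ _) (by simp)
      (by simp) ?_
    rw [lseq_glue, hp]; decide +kernel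

lemma lam_glue_lt (hg : ∀ n, g n = 1 ∨ g n = 2) (k : ℕ) :
    lam (glue g) (-(9 * (k + 1 : ℕ) : ℤ)) < ((31181201781500 * 10 ^ 9 : ℕ) : ℝ) / 10 ^ 22 := by
  have hA := glue_pos hg
  have hl : lseq (glue g) (-(9 * (k + 1 : ℕ) : ℤ)) = lper := by
    rw [← lseq_glue g]
    funext j
    rw [lseq, lseq, ← glue_sub g (k + 1) (n := 0 - 1 - j) (by omega)]
    congr 1; push_cast; ring
  have hr : pre (rseq (glue g) (-(9 * (k + 1 : ℕ) : ℤ))) 18 = pre rper 18 := by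
    refine pre_congr fun j hj => ?_
    rw [rseq, show -(9 * (k + 1 : ℕ) : ℤ) + 1 + j = (-8 + j : ℤ) - 9 * k by push_cast; ring,
      glue_sub g k (by omega)]
    interval_cases j <;> rfl
  refine lam_lt_of_below (m := 45) (n := 18) (K := 60) hA ?_ (fun n _ _ => glue_mem hg n)
    (by simp) (by simp) ?_
  · rw [← glue_zero g, ← glue_sub g (k + 1) (n := 0) (by omega)]
    congr 1
  · rw [hl, hr]; decide +kernel

lemma lam_glue_mem (hg : ∀ n, g n = 1 ∨ g n = 2) (hP : avoidsP g) (hq : q ∈ qWords)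
    (hpre : pre g q.length = q) :
    lam (glue g) 0 ∈ (MarkovSpectrum \ LagrangeSpectrum) ∩ Ioo cInf CInf := by
  have hA := glue_pos hg
  obtain ⟨hlo, hhi⟩ := lt_lam_glue hg
  have h1 : cInf < lam (glue g) 0 := by
    have := cInf_bounds.2
    norm_num at this hlo ⊢
    linarith
  have h2 : lam (glue g) 0 < CInf := by
    have := CInf_bounds.1
    norm_num at this hhi ⊢
    linarith
  have hmax : ∀ i, lam (glue g) i ≤ lam (glue g) 0 := by
    intro i
    rcases lam_lt_or_sp hA (i := i) (fun n _ _ => glue_mem hg n)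
      (fun w hw s _ _ => not_occursAtZ_glue hP hq hpre (List.mem_cons_of_mem _ hw) s)
      with h | h | h
    · norm_num at h hlo ⊢
      linarith
    · obtain ⟨k, rfl⟩ := exists_of_sp_glue hP hq hpre h
      cases k with
      | zero => simp
      | succ k =>
        have := lam_glue_lt hg k
        norm_num at this hlo ⊢
        linarith
    · exact absurd h (not_sp_rev_glue hP hq hpre _)
  have hM : lam (glue g) 0 = markovVal (glue g) :=
    (IsGreatest.csSup_eq (s := range (lam (glue g)))
      ⟨⟨0, rfl⟩, by rintro - ⟨i, rfl⟩; exact hmax i⟩).symm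
  exact ⟨⟨⟨glue g, hA, ⟨lam (glue g) 0, by rintro - ⟨i, rfl⟩; exact hmax i⟩, hM⟩,
    not_mem_lagrangeSpectrum h1 h2⟩, h1, h2⟩

end

lemma dimH_Yset_le_dimH_inter :
    dimH Yset ≤ dimH ((MarkovSpectrum \ LagrangeSpectrum) ∩ Ioo cInf CInf) := by
  refine dimH_Yset_le.trans ((dimH_le_dimH_image_mob (w := rWord) (by decide) 2 (cf0 lper)
    Ystart_subset).trans (dimH_mono ?_))
  rintro - ⟨-, ⟨g, hg, hP, ⟨q, hq, hpre⟩, rfl⟩, rfl⟩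
  have hA := glue_pos hg
  have h := lam_glue_mem hg hP hq hpre
  rw [lam_eq hA, lseq_glue, rseq_glue, cf0_catSeq (by decide) (pos_of_mem hg), glue_zero] at h
  exact h

/-- `HD((M \ L) ∩ (c_∞, C_∞)) = HD(Y)`. -/
theorem hd_eq :
    dimH ((MarkovSpectrum \ LagrangeSpectrum) ∩ Ioo cInf CInf) = dimH Yset :=
  le_antisymm dimH_inter_le_dimH_Yset dimH_Yset_le_dimH_inter
end

section
/- Let B in {1,2}^Z be a bi-infinite sequence such that B_{-6} B_{-5} ... B_8 = 2 1_2 2_4 1 2_2 1_2 2_3 and lambda_n(B) < 3.1181201786 for every n in {0, -6, -9, 11, 15}. Then B_{-14} B_{-13} ... B_{16} = 1_2 2_4 1 2_2 1_2 2_4 1 2_2 1_2 2_4 1 2_2 1_2 2_2. -/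
open Filter Set

/-! ### Convergence of continued fractions with digits in `{1, 2}` -/

lemma cfConv_mem_Icc {g : ℕ → ℕ} (hg : ∀ n, g n = 1 ∨ g n = 2) (n : ℕ) :
    cfConv g n ∈ Icc (1 : ℝ) 3 := by
  induction n generalizing g with
  | zero => rcases hg 0 with h | h <;> norm_num [cfConv, h]
  | succ n ih =>
    obtain ⟨h₁, -⟩ := ih fun i => hg (i + 1)
    have hpos := one_div_pos.2 (zero_lt_one.trans_le h₁)
    have hle := (div_le_one (zero_lt_one.trans_le h₁)).2 h₁
    rcases hg 0 with h | h <;> simp only [cfConv, h, mem_Icc] <;> constructor <;>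
      push_cast <;> linarith

lemma four_thirds_le_cfConv_succ {g : ℕ → ℕ} (hg : ∀ n, g n = 1 ∨ g n = 2) (n : ℕ) :
    4 / 3 ≤ cfConv g (n + 1) := by
  obtain ⟨h₁, h₃⟩ := cfConv_mem_Icc (fun i => hg (i + 1)) n
  have hinv := one_div_le_one_div_of_le (zero_lt_one.trans_le h₁) h₃
  rcases hg 0 with h | h <;> simp only [cfConv, h] <;> push_cast <;> linarith

lemma dist_cfConv_succ_le {g : ℕ → ℕ} (hg : ∀ n, g n = 1 ∨ g n = 2) (n : ℕ) :
    dist (cfConv g n) (cfConv g (n + 1)) ≤ 1 * (3 / 4 : ℝ) ^ n := by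
  induction n generalizing g with
  | zero =>
    obtain ⟨h₁, -⟩ := cfConv_mem_Icc (fun i => hg (i + 1)) 0
    have hpos : (0 : ℝ) < cfConv (fun i => g (i + 1)) 0 := by linarith
    rw [dist_comm, Real.dist_eq, cfConv, cfConv, add_sub_cancel_left,
      abs_of_pos (one_div_pos.2 hpos), pow_zero, mul_one]
    exact (div_le_one hpos).2 h₁
  | succ n ih =>
    have hg' := fun i => hg (i + 1)
    have hd := ih hg'
    have hx := (cfConv_mem_Icc hg' n).1
    have hy := four_thirds_le_cfConv_succ hg' n
    rw [cfConv, cfConv]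
    set x := cfConv (fun i => g (i + 1)) n
    set y := cfConv (fun i => g (i + 1)) (n + 1)
    have hx0 : 0 < x := by linarith
    have hy0 : 0 < y := by linarith
    have hxy : 4 / 3 ≤ x * y := by nlinarith
    rw [dist_add_left, Real.dist_eq, one_div, one_div, inv_sub_inv hx0.ne' hy0.ne', abs_div,
      abs_of_pos (mul_pos hx0 hy0), div_le_iff₀ (mul_pos hx0 hy0), ← Real.dist_eq, dist_comm]
    have hp : (0 : ℝ) ≤ (3 / 4) ^ n := by positivity
    rw [pow_succ]
    nlinarith

lemma tendsto_cfConv_cfVal {g : ℕ → ℕ} (hg : ∀ n, g n = 1 ∨ g n = 2) :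
    Tendsto (cfConv g) atTop (nhds (cfVal g)) :=
  (cauchySeq_of_le_geometric _ _ (by norm_num) (dist_cfConv_succ_le hg)).tendsto_limUnder

lemma cfVal_mem_Icc {g : ℕ → ℕ} (hg : ∀ n, g n = 1 ∨ g n = 2) : cfVal g ∈ Icc (1 : ℝ) 3 :=
  isClosed_Icc.mem_of_tendsto (tendsto_cfConv_cfVal hg) (.of_forall (cfConv_mem_Icc hg))

/-- The recursion `[g 0; g 1, ...] = g 0 + 1 / [g 1; g 2, ...]`; the first digit is arbitrary. -/
lemma cfVal_eq_add_one_div {g : ℕ → ℕ} (hg : ∀ n, g (n + 1) = 1 ∨ g (n + 1) = 2) :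
    cfVal g = g 0 + 1 / cfVal (fun n => g (n + 1)) := by
  have hne : cfVal (fun n => g (n + 1)) ≠ 0 :=
    (zero_lt_one.trans_le (cfVal_mem_Icc hg).1).ne'
  refine Tendsto.limUnder_eq ((tendsto_add_atTop_iff_nat 1).1 ?_)
  exact (tendsto_const_nhds.div (tendsto_cfConv_cfVal hg) hne).const_add _

lemma cf0_eq_one_div {g : ℕ → ℕ} (hg : ∀ n, g n = 1 ∨ g n = 2) : cf0 g = 1 / cfVal g := by
  rw [cf0, cfVal_eq_add_one_div (by simpa using hg)]
  simp

/-! ### Rational bounds from finitely many digits -/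

/-- Lower and upper bounds for continued fractions with digits in `{1, 2}` starting with a given
word. -/
def cfBounds : List ℕ → ℚ × ℚ
  | [] => (15 / 11, 41 / 15)
  | a :: l => (a + 1 / (cfBounds l).2, a + 1 / (cfBounds l).1)

/-- Lower bound for `λ` at position `k` of an occurrence of the word `w`. -/
def lamLower (w : List ℕ) (k : ℕ) : ℚ :=
  (cfBounds (w.drop k)).1 + 1 / (cfBounds (w.take k).reverse).2

lemma cfBounds_pos (l : List ℕ) : 0 < (cfBounds l).1 ∧ 0 < (cfBounds l).2 := by
  induction l with
  | nil => norm_num [cfBounds]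
  | cons a l ih =>
    obtain ⟨h₁, h₂⟩ := ih
    constructor <;> simp only [cfBounds] <;> positivity

lemma cfVal_mem_Icc_of_digits {g : ℕ → ℕ} (hg : ∀ n, g n = 1 ∨ g n = 2) :
    cfVal g ∈ Icc (15 / 11 : ℝ) (41 / 15) := by
  have key {c d : ℝ} (hc : 0 < c)
      (H : ∀ f : ℕ → ℕ, (∀ n, f n = 1 ∨ f n = 2) → cfVal f ∈ Icc c d)
      (f : ℕ → ℕ) (hf : ∀ n, f n = 1 ∨ f n = 2) : cfVal f ∈ Icc (1 + 1 / d) (2 + 1 / c) := by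
    obtain ⟨h₁, h₂⟩ := H _ fun n => hf (n + 1)
    have hd := one_div_le_one_div_of_le (hc.trans_le h₁) h₂
    have hc' := one_div_le_one_div_of_le hc h₁
    rw [cfVal_eq_add_one_div fun n => hf (n + 1)]
    rcases hf 0 with h | h <;> rw [h] <;> constructor <;> push_cast <;> linarith
  have h := key (by norm_num) (key (by norm_num) (key (by norm_num) (key (by norm_num)
    fun f hf => cfVal_mem_Icc hf))) g hg
  norm_num at h ⊢
  constructor <;> linarith [h.1, h.2]

/-- The value of a continued fraction starting with the word `l` lies between the bounds. -/
lemma cfVal_mem_cfBounds {g : ℕ → ℕ} (hg : ∀ n, g n = 1 ∨ g n = 2) {l : List ℕ}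
    (hl : ∀ (i : ℕ) (hi : i < l.length), g i = l[i]) :
    cfVal g ∈ Icc ((cfBounds l).1 : ℝ) (cfBounds l).2 := by
  induction l generalizing g with
  | nil => simpa [cfBounds] using cfVal_mem_Icc_of_digits hg
  | cons a l ih =>
    have hg' := fun n => hg (n + 1)
    obtain ⟨h₁, h₂⟩ := ih hg' fun i hi => hl (i + 1) (by simpa using hi)
    have hpos : (0 : ℝ) < (cfBounds l).1 := by exact_mod_cast (cfBounds_pos l).1
    have h0 : g 0 = a := hl 0 (by simp)
    rw [cfVal_eq_add_one_div hg', h0]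
    simp only [cfBounds, mem_Icc]
    push_cast
    exact ⟨by gcongr; exact hpos.trans_le h₁, by gcongr⟩

lemma lamLower_le_lam {B : ℤ → ℕ} (hB : ∀ n, B n = 1 ∨ B n = 2) {w : List ℕ} {j : ℤ}
    (hw : occursAtZ w B j) {k : ℕ} (hk : k ≤ w.length) :
    (lamLower w k : ℝ) ≤ lam B (j + k) := by
  have hr := (cfVal_mem_cfBounds (g := fun n => B (j + k + n)) (fun n => hB _) (l := w.drop k)
    fun i hi => by
      rw [List.length_drop] at hi
      have := hw (k + i) (by omega)
      rw [List.getD_eq_getElem _ _ (by omega)] at this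
      simpa [add_assoc] using this).1
  have hl := cfVal_mem_cfBounds (g := fun n => B (j + k - 1 - n)) (fun n => hB _)
    (l := (w.take k).reverse) fun i hi => by
      rw [List.length_reverse, List.length_take] at hi
      have hi' : k - 1 - i < w.length := by omega
      have := hw (k - 1 - i) hi'
      rw [List.getD_eq_getElem _ _ hi'] at this
      rw [List.getElem_reverse, List.getElem_take]
      have hlen : (w.take k).length - 1 - i = k - 1 - i := by rw [List.length_take]; omega
      simp only [hlen, ← this]
      congr 1
      omega
  have hpos : (0 : ℝ) < cfVal fun n : ℕ => B (j + k - 1 - n) :=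
    zero_lt_one.trans_le (cfVal_mem_Icc fun n => hB _).1
  rw [lam, cf0_eq_one_div fun n => hB _, lamLower]
  push_cast
  gcongr
  exact hl.2

lemma occursAtZ.append_singleton {B : ℤ → ℕ} {w : List ℕ} {j : ℤ} (hw : occursAtZ w B j) {d : ℕ}
    (hd : B (j + w.length) = d) : occursAtZ (w ++ [d]) B j := by
  intro i hi
  rw [List.length_append, List.length_singleton] at hi
  rcases Nat.lt_succ_iff_lt_or_eq.1 hi with h | rfl
  · rw [List.getD_append _ _ _ _ h, hw i h]
  · simpa using hd

lemma occursAtZ.cons {B : ℤ → ℕ} {w : List ℕ} {j : ℤ} (hw : occursAtZ w B j) {d : ℕ}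
    (hd : B (j - 1) = d) : occursAtZ (d :: w) B (j - 1) := by
  rintro (_ | i) hi
  · simpa using hd
  · have := hw i (by simpa using hi)
    simpa [sub_add_add_cancel, add_comm] using this

/-- If every digit in `{1, 2}` other than `d` would force a value of `λ` that is too large,
then the occurrence of `w` extends to the left by `d`. -/
lemma occursAtZ.extendLeft {B : ℤ → ℕ} {w : List ℕ} {j : ℤ} (hw : occursAtZ w B j)
    (hB : ∀ n, B n = 1 ∨ B n = 2) {d : ℕ} (k : ℕ) {n : ℤ} {c : ℚ} (hlam : lam B n < c)
    (hk : k ≤ w.length) (hn : j - 1 + k = n)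
    (hc : ∀ e ∈ [1, 2], e ≠ d → c ≤ lamLower (e :: w) k) :
    occursAtZ (d :: w) B (j - 1) := by
  refine hw.cons (by_contra fun hne => hlam.not_ge ?_)
  have hle : c ≤ lamLower (B (j - 1) :: w) k := hc _ (by simpa using hB (j - 1)) hne
  exact hn ▸ (Rat.cast_le.2 hle).trans (lamLower_le_lam hB (hw.cons rfl) (hk.trans (by simp)))

/-- If every digit in `{1, 2}` other than `d` would force a value of `λ` that is too large,
then the occurrence of `w` extends to the right by `d`. -/
lemma occursAtZ.extendRight {B : ℤ → ℕ} {w : List ℕ} {j : ℤ} (hw : occursAtZ w B j)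
    (hB : ∀ n, B n = 1 ∨ B n = 2) {d : ℕ} (k : ℕ) {n : ℤ} {c : ℚ} (hlam : lam B n < c)
    (hk : k ≤ w.length) (hn : j + k = n)
    (hc : ∀ e ∈ [1, 2], e ≠ d → c ≤ lamLower (w ++ [e]) k) :
    occursAtZ (w ++ [d]) B j := by
  refine hw.append_singleton (by_contra fun hne => hlam.not_ge ?_)
  have hle : c ≤ lamLower (w ++ [B (j + w.length)]) k := hc _ (by simpa using hB _) hne
  exact hn ▸ (Rat.cast_le.2 hle).trans (lamLower_le_lam hB (hw.append_singleton rfl)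
    (hk.trans (by simp)))

/-- extension lemma. -/
theorem extension_lemma (B : ℤ → ℕ) (hB : ∀ n, B n = 1 ∨ B n = 2)
    (hw : occursAtZ spWord B (-6))
    (h : ∀ n ∈ ({0, -6, -9, 11, 15} : Set ℤ), lam B n < 3.1181201786) :
    occursAtZ bigWord B (-14) := by
  have hlam : ∀ n ∈ ({0, -6, -9, 11, 15} : Set ℤ),
      lam B n < ((3.1181201786 : ℚ) : ℝ) := by
    norm_num at h ⊢
    exact h
  replace hw := hw.extendLeft hB (d := 2) 7 (hlam 0 (by simp)) (by decide)
    (by norm_num) (by norm_num [lamLower, cfBounds, spWord])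
  replace hw := hw.extendLeft hB (d := 1) 8 (hlam 0 (by simp)) (by decide)
    (by norm_num) (by norm_num [lamLower, cfBounds, spWord])
  replace hw := hw.extendLeft hB (d := 2) 9 (hlam 0 (by simp)) (by decide)
    (by norm_num) (by norm_num [lamLower, cfBounds, spWord])
  replace hw := hw.extendLeft hB (d := 2) 1 (hlam (-9) (by simp)) (by decide)
    (by norm_num) (by norm_num [lamLower, cfBounds, spWord])
  replace hw := hw.extendRight hB (d := 2) 10 (hlam 0 (by simp)) (by decide)
    (by norm_num) (by norm_num [lamLower, cfBounds, spWord])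
  replace hw := hw.extendRight hB (d := 1) 10 (hlam 0 (by simp)) (by decide)
    (by norm_num) (by norm_num [lamLower, cfBounds, spWord])
  replace hw := hw.extendRight hB (d := 2) 10 (hlam 0 (by simp)) (by decide)
    (by norm_num) (by norm_num [lamLower, cfBounds, spWord])
  replace hw := hw.extendRight hB (d := 2) 21 (hlam 11 (by simp)) (by decide)
    (by norm_num) (by norm_num [lamLower, cfBounds, spWord])
  replace hw := hw.extendLeft hB (d := 2) 11 (hlam 0 (by simp)) (by decide)
    (by norm_num) (by norm_num [lamLower, cfBounds, spWord])
  replace hw := hw.extendLeft hB (d := 2) 3 (hlam (-9) (by simp)) (by decide)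
    (by norm_num) (by norm_num [lamLower, cfBounds, spWord])
  replace hw := hw.extendLeft hB (d := 1) 4 (hlam (-9) (by simp)) (by decide)
    (by norm_num) (by norm_num [lamLower, cfBounds, spWord])
  replace hw := hw.extendRight hB (d := 1) 24 (hlam 11 (by simp)) (by decide)
    (by norm_num) (by norm_num [lamLower, cfBounds, spWord])
  replace hw := hw.extendLeft hB (d := 1) 14 (hlam 0 (by simp)) (by decide)
    (by norm_num) (by norm_num [lamLower, cfBounds, spWord])
  replace hw := hw.extendRight hB (d := 1) 14 (hlam 0 (by simp)) (by decide)
    (by norm_num) (by norm_num [lamLower, cfBounds, spWord])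
  replace hw := hw.extendRight hB (d := 2) 14 (hlam 0 (by simp)) (by decide)
    (by norm_num) (by norm_num [lamLower, cfBounds, spWord])
  replace hw := hw.extendRight hB (d := 2) 29 (hlam 15 (by simp)) (by decide)
    (by norm_num) (by norm_num [lamLower, cfBounds, spWord])
  exact hw
end
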